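/- Packing entropy inequalities for factor maps: Let G be a countable infinite discrete amenable group and π : (X,G) → (Y,G) a factor map between two G-action topological dynamical systems. Let {F_n} be a tempered Følner sequence in G satisfying the growth condition. Then for any Borel subset E of X, h^P_top(π(E),{F_n}) ≤ h^P_top(E,{F_n}) ≤ h^P_top(π(E),{F_n}) + sup_{y∈Y} h^{UC}_top(π⁻¹(y),{F_n}). -/

import Mathlib

open Filter Set MeasureTheory ENNReal Topology
open scoped Pointwise symmDiff NNReal

namespace AmenablePacking

variable {G X Y : Type*}

/-- The open dynamical (Bowen) ball of center `x` and radius `ε` over the finite set `F`. -/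
def dynBall [PseudoMetricSpace X] (act : G → X → X) (F : Finset G) (x : X) (ε : ℝ) : Set X :=
  {y | ∀ g ∈ F, dist (act g x) (act g y) < ε}

/-- The closed dynamical (Bowen) ball of center `x` and radius `ε` over the finite set `F`. -/
def dynClosedBall [PseudoMetricSpace X] (act : G → X → X) (F : Finset G) (x : X) (ε : ℝ) :
    Set X :=
  {y | ∀ g ∈ F, dist (act g x) (act g y) ≤ ε}

/-- The packing pre-measure `P(Z, N, ε, s, {F_n})`: the supremum of `∑ᵢ exp (- s |F_{n_i}|)` over
all finite or countable pairwise disjoint families of closed Bowen balls with centers in `Z`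
and indices `n_i ≥ N`. -/
noncomputable def packP [PseudoMetricSpace X] (act : G → X → X) (Fs : ℕ → Finset G) (Z : Set X)
    (N : ℕ) (ε s : ℝ) : ℝ≥0∞ :=
  ⨆ (t : Set ℕ) (c : ℕ → X × ℕ) (_ : ∀ i ∈ t, (c i).1 ∈ Z ∧ N ≤ (c i).2)
    (_ : ∀ i ∈ t, ∀ j ∈ t, i ≠ j →
      Disjoint (dynClosedBall act (Fs (c i).2) (c i).1 ε)
        (dynClosedBall act (Fs (c j).2) (c j).1 ε)),
    ∑' i : t, ENNReal.ofReal (Real.exp (-s * ((Fs (c (i : ℕ)).2).card : ℝ)))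

/-- `P(Z, ε, s, {F_n}) = lim_{N → ∞} P(Z, N, ε, s, {F_n})`; the quantity is non-increasing
in `N`, so the limit equals the infimum. -/
noncomputable def packPLim [PseudoMetricSpace X] (act : G → X → X) (Fs : ℕ → Finset G)
    (Z : Set X) (ε s : ℝ) : ℝ≥0∞ :=
  ⨅ N : ℕ, packP act Fs Z N ε s

/-- `𝒫(Z, ε, s, {F_n})`: the countably subadditive envelope of `P(·, ε, s, {F_n})`. -/
noncomputable def packOuter [PseudoMetricSpace X] (act : G → X → X) (Fs : ℕ → Finset G)
    (Z : Set X) (ε s : ℝ) : ℝ≥0∞ :=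
  ⨅ (Zs : ℕ → Set X) (_ : Z ⊆ ⋃ i, Zs i), ∑' i, packPLim act Fs (Zs i) ε s

/-- `h^P_top(Z, ε, {F_n})`: the critical value of `s ≥ 0` at which `𝒫(Z, ε, s, {F_n})` jumps
from `+∞` to `0`. -/
noncomputable def packEntEps [PseudoMetricSpace X] (act : G → X → X) (Fs : ℕ → Finset G)
    (Z : Set X) (ε : ℝ) : ℝ≥0∞ :=
  ⨅ (s : ℝ≥0) (_ : packOuter act Fs Z ε (s : ℝ) = 0), (s : ℝ≥0∞)

/-- The amenable packing topological entropy
`h^P_top(Z, {F_n}) = lim_{ε → 0} h^P_top(Z, ε, {F_n})`. -/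
noncomputable def packEnt [PseudoMetricSpace X] (act : G → X → X) (Fs : ℕ → Finset G)
    (Z : Set X) : ℝ≥0∞ :=
  ⨆ (ε : ℝ) (_ : 0 < ε), packEntEps act Fs Z ε

/-- The Bowen pre-measure `ℳ(Z, N, ε, s, {F_n})`: the infimum of `∑ᵢ exp (- s |F_{n_i}|)` over
all finite or countable families of open Bowen balls with indices `n_i ≥ N` covering `Z`. -/
noncomputable def bowenM [PseudoMetricSpace X] (act : G → X → X) (Fs : ℕ → Finset G) (Z : Set X)
    (N : ℕ) (ε s : ℝ) : ℝ≥0∞ :=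
  ⨅ (t : Set ℕ) (c : ℕ → X × ℕ) (_ : ∀ i ∈ t, N ≤ (c i).2)
    (_ : Z ⊆ ⋃ i ∈ t, dynBall act (Fs (c i).2) (c i).1 ε),
    ∑' i : t, ENNReal.ofReal (Real.exp (-s * ((Fs (c (i : ℕ)).2).card : ℝ)))

/-- `ℳ(Z, s, {F_n}) = lim_{ε → 0} lim_{N → ∞} ℳ(Z, N, ε, s, {F_n})`. -/
noncomputable def bowenMLim [PseudoMetricSpace X] (act : G → X → X) (Fs : ℕ → Finset G)
    (Z : Set X) (s : ℝ) : ℝ≥0∞ :=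
  ⨆ (ε : ℝ) (_ : 0 < ε), ⨆ N : ℕ, bowenM act Fs Z N ε s

/-- The amenable Bowen topological entropy `h^B_top(Z, {F_n})`: the critical value of `s ≥ 0`
at which `ℳ(Z, s, {F_n})` jumps from `+∞` to `0`. -/
noncomputable def bowenEnt [PseudoMetricSpace X] (act : G → X → X) (Fs : ℕ → Finset G)
    (Z : Set X) : ℝ≥0∞ :=
  ⨅ (s : ℝ≥0) (_ : bowenMLim act Fs Z (s : ℝ) = 0), (s : ℝ≥0∞)

/-- `E` is an `(F, ε)`-separated set: distinct points are at `d_F`-distance `> ε`. -/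
def IsDynSeparated [PseudoMetricSpace X] (act : G → X → X) (F : Finset G) (ε : ℝ)
    (E : Set X) : Prop :=
  ∀ x ∈ E, ∀ y ∈ E, x ≠ y → ∃ g ∈ F, ε < dist (act g x) (act g y)

/-- `s_F(Z, ε)`: the maximal cardinality of an `(F, ε)`-separated subset of `Z`. -/
noncomputable def sepNum [PseudoMetricSpace X] (act : G → X → X) (F : Finset G) (Z : Set X)
    (ε : ℝ) : ℕ :=
  sSup {k : ℕ | ∃ E : Finset X, ↑E ⊆ Z ∧ IsDynSeparated act F ε ↑E ∧ E.card = k}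

/-- The upper capacity entropy of `Z` at scale `ε`:
`limsup_n (1/|F_n|) log s_{F_n}(Z, ε)`. -/
noncomputable def ucEntEps [PseudoMetricSpace X] (act : G → X → X) (Fs : ℕ → Finset G)
    (Z : Set X) (ε : ℝ) : ℝ≥0∞ :=
  limsup (fun n => ENNReal.ofReal (Real.log ((sepNum act (Fs n) Z ε : ℝ)) / ((Fs n).card : ℝ)))
    atTop

/-- The upper capacity topological entropy `h^{UC}_top(Z, {F_n})`. -/
noncomputable def ucEnt [PseudoMetricSpace X] (act : G → X → X) (Fs : ℕ → Finset G)
    (Z : Set X) : ℝ≥0∞ :=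
  ⨆ (ε : ℝ) (_ : 0 < ε), ucEntEps act Fs Z ε

/-- The upper local entropy `h̄^loc_μ(Z, {F_n}) =
`∫_Z lim_{ε→0} limsup_n -(1/|F_n|) log μ(B_{F_n}(x, ε)) dμ`. -/
noncomputable def upperLocalEnt [PseudoMetricSpace X] [MeasurableSpace X] (act : G → X → X)
    (Fs : ℕ → Finset G) (μ : Measure X) (Z : Set X) : ℝ≥0∞ :=
  ∫⁻ x in Z, ⨆ (ε : ℝ) (_ : 0 < ε),
    limsup (fun n =>
      ENNReal.ofReal (-Real.log ((μ (dynBall act (Fs n) x ε)).toReal) / ((Fs n).card : ℝ)))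
      atTop ∂μ

/-- A Følner sequence: a sequence of nonempty finite subsets of `G` which is asymptotically
invariant, i.e. `|g F_n ∆ F_n| / |F_n| → 0` for every `g ∈ G`. -/
def Folner [Group G] [DecidableEq G] (Fs : ℕ → Finset G) : Prop :=
  (∀ n, (Fs n).Nonempty) ∧
    ∀ g : G,
      Tendsto (fun n => ((((Fs n).image fun h => g * h) ∆ Fs n).card : ℝ) / ((Fs n).card : ℝ))
        atTop (nhds 0)

/-- A tempered sequence: `|⋃_{k < n} F_k⁻¹ F_n| ≤ C |F_n|` for a constant `C > 0`. -/
def Tempered [Group G] [DecidableEq G] (Fs : ℕ → Finset G) : Prop :=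
  ∃ C : ℝ, 0 < C ∧
    ∀ n : ℕ, ((((Finset.range n).biUnion fun k => (Fs k)⁻¹ * Fs n).card : ℝ))
      ≤ C * ((Fs n).card : ℝ)

/-- The growth condition `lim_n |F_n| / log n = +∞`. -/
def GrowthCond (Fs : ℕ → Finset G) [Group G] : Prop :=
  Tendsto (fun n => ((Fs n).card : ℝ) / Real.log (n : ℝ)) atTop atTop

/-- The static (Shannon) entropy of the finite measurable partition of `X` induced by a map
into a finite set. -/
noncomputable def partEnt [MeasurableSpace X] (μ : Measure X) {ι : Type*} [Fintype ι]
    (P : X → ι) : ℝ :=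
  ∑ i : ι, Real.negMulLog ((μ (P ⁻¹' {i})).toReal)

/-- The measure-theoretic (Kolmogorov–Sinai) entropy `h_μ(X, G)` of the action w.r.t. the
invariant measure `μ`, computed along the Følner sequence `{F_n}`: the supremum over finite
measurable partitions `P` of `lim_n (1/|F_n|) H_μ(⋁_{g ∈ F_n} (act g)⁻¹ P)`. -/
noncomputable def measEnt [MeasurableSpace X] [DecidableEq G] (act : G → X → X)
    (Fs : ℕ → Finset G) (μ : Measure X) : ℝ≥0∞ :=
  ⨆ (k : ℕ) (P : X → Fin k) (_ : Measurable P),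
    limsup (fun n => ENNReal.ofReal
      ((partEnt μ fun x (g : (Fs n : Finset G)) => P (act (g : G) x)) / ((Fs n).card : ℝ)))
      atTop

/-- The set of generic points of `μ` w.r.t. `{F_n}`. -/
def genericPoints [TopologicalSpace X] [MeasurableSpace X] (act : G → X → X)
    (Fs : ℕ → Finset G) (μ : Measure X) : Set X :=
  {x | ∀ f : C(X, ℝ),
    Tendsto (fun n => (∑ g ∈ Fs n, f (act g x)) / ((Fs n).card : ℝ)) atTop
      (nhds (∫ y, f y ∂μ))}

/-- `μ` is invariant under the action. -/
def InvariantMeasure [MeasurableSpace X] (act : G → X → X) (μ : Measure X) : Prop :=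
  ∀ (g : G) (s : Set X), MeasurableSet s → μ (act g ⁻¹' s) = μ s

/-- The action is ergodic w.r.t. `μ`: every invariant measurable set is null or conull. -/
def ErgodicAction [MeasurableSpace X] (act : G → X → X) (μ : Measure X) : Prop :=
  ∀ s : Set X, MeasurableSet s → (∀ g : G, act g ⁻¹' s = s) → μ s = 0 ∨ μ s = 1

theorem sum_inv_card_fiber_le {α V : Type*} [Fintype V] [DecidableEq V] (A : Finset α) (φ : α → V) :
    ∑ a ∈ A, ((A.filter fun b => φ b = φ a).card : ℝ)⁻¹ ≤ Fintype.card V := by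
  rw [← Finset.sum_fiberwise A φ]
  calc _ ≤ ∑ _v : V, (1 : ℝ) := by
        refine Finset.sum_le_sum fun v _ => ?_
        rw [Finset.sum_congr rfl (g := fun _ => ((A.filter fun b => φ b = v).card : ℝ)⁻¹)
          fun a ha => by rw [(Finset.mem_filter.1 ha).2]]
        rw [Finset.sum_const, nsmul_eq_mul]
        exact mul_inv_le_one
    _ = _ := by simp

section NameEntropy

variable {α ι κ : Type*} [DecidableEq κ]

/-- The number of points of `A` whose name agrees with that of `a` at every position in `T`. -/
def nameClass (A : Finset α) (name : α → ι → κ) (T : Finset ι) (a : α) : ℕ :=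
  (A.filter fun b => ∀ g ∈ T, name b g = name a g).card

/-- `|A|` times the Shannon entropy of the `T`-name of a uniformly distributed point of `A`. -/
noncomputable def nameEntropy (A : Finset α) (name : α → ι → κ) (T : Finset ι) : ℝ :=
  ∑ a ∈ A, (Real.log A.card - Real.log (nameClass A name T a))

theorem nameClass_pos {A : Finset α} (name : α → ι → κ) (T : Finset ι) {a : α} (ha : a ∈ A) :
    0 < nameClass A name T a :=
  Finset.card_pos.2 ⟨a, by simp [ha]⟩

theorem nameClass_anti (A : Finset α) (name : α → ι → κ) {S T : Finset ι} (h : S ⊆ T) (a : α) :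
    nameClass A name T a ≤ nameClass A name S a :=
  Finset.card_le_card (Finset.monotone_filter_right _ fun _ _ hb g hg => hb g (h hg))

theorem nameClass_congr (A : Finset α) (name : α → ι → κ) {T : Finset ι} {a b : α}
    (h : ∀ g ∈ T, name a g = name b g) : nameClass A name T a = nameClass A name T b := by
  unfold nameClass
  congr 1
  refine Finset.filter_congr fun c _ => ?_
  exact ⟨fun hc g hg => (hc g hg).trans (h g hg), fun hc g hg => (hc g hg).trans (h g hg).symm⟩

theorem nameEntropy_empty (A : Finset α) (name : α → ι → κ) : nameEntropy A name ∅ = 0 := by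
  simp [nameEntropy, nameClass]

theorem nameEntropy_mono (A : Finset α) (name : α → ι → κ) {S T : Finset ι} (h : S ⊆ T) :
    nameEntropy A name S ≤ nameEntropy A name T := by
  refine Finset.sum_le_sum fun a ha => ?_
  have h1 : (0 : ℝ) < nameClass A name T a := by exact_mod_cast nameClass_pos name T ha
  have h2 : (nameClass A name T a : ℝ) ≤ nameClass A name S a := by
    exact_mod_cast nameClass_anti A name h a
  have := Real.log_le_log h1 h2
  linarith

theorem nameEntropy_of_injOn (A : Finset α) (name : α → ι → κ) {T : Finset ι}
    (h : ∀ a ∈ A, ∀ b ∈ A, (∀ g ∈ T, name b g = name a g) → b = a) :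
    nameEntropy A name T = A.card * Real.log A.card := by
  have : ∀ a ∈ A, Real.log A.card - Real.log (nameClass A name T a) = Real.log A.card := by
    intro a ha
    have : A.filter (fun b => ∀ g ∈ T, name b g = name a g) = {a} := by
      ext b
      simp only [Finset.mem_filter, Finset.mem_singleton]
      exact ⟨fun hb => h a ha b hb.1 hb.2, fun hb => by subst hb; simp [ha]⟩
    simp [nameClass, this]
  rw [nameEntropy, Finset.sum_congr rfl this]
  simp

variable [DecidableEq ι]

theorem sum_nameClass_ratio_le (A : Finset α) (name : α → ι → κ) {U R S : Finset ι}
    (hR : U ⊆ R) (hS : U ⊆ S) :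
    ∑ a ∈ A, (nameClass A name R a : ℝ) * nameClass A name S a /
      (nameClass A name U a * nameClass A name (R ∪ S) a) ≤ A.card := by
  classical
  have expand : ∀ (T : Finset ι) (a : α), (nameClass A name T a : ℝ) =
      ∑ b ∈ A, if ∀ g ∈ T, name b g = name a g then (1 : ℝ) else 0 := by
    intro T a
    simp [nameClass]
  have key : ∀ a ∈ A, (nameClass A name R a : ℝ) * nameClass A name S a /
      (nameClass A name U a * nameClass A name (R ∪ S) a) =
      ∑ b ∈ A, ∑ c ∈ A, if (∀ g ∈ R, name b g = name a g) ∧ (∀ g ∈ S, name c g = name a g) then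
        (nameClass A name U a : ℝ)⁻¹ * (nameClass A name (R ∪ S) a : ℝ)⁻¹ else 0 := by
    intro a _
    rw [expand R, expand S, Finset.sum_mul_sum, Finset.sum_div]
    refine Finset.sum_congr rfl fun b _ => ?_
    rw [Finset.sum_div]
    refine Finset.sum_congr rfl fun c _ => ?_
    by_cases h1 : ∀ g ∈ R, name b g = name a g
    · by_cases h2 : ∀ g ∈ S, name c g = name a g
      · rw [if_pos h1, if_pos h2, if_pos ⟨h1, h2⟩, mul_one, one_div, mul_inv]
      · rw [if_neg h2, if_neg (c := _ ∧ _) fun h => h2 h.2, mul_zero, zero_div]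
    · rw [if_neg h1, if_neg (c := _ ∧ _) fun h => h1 h.1, zero_mul, zero_div]
  rw [Finset.sum_congr rfl key, Finset.sum_comm]
  have bound : ∀ b ∈ A, ∑ a ∈ A, ∑ c ∈ A,
      (if (∀ g ∈ R, name b g = name a g) ∧ (∀ g ∈ S, name c g = name a g) then
        (nameClass A name U a : ℝ)⁻¹ * (nameClass A name (R ∪ S) a : ℝ)⁻¹ else 0) ≤ 1 := by
    intro b hb
    rw [Finset.sum_comm]
    have inner : ∀ c ∈ A, ∑ a ∈ A,
        (if (∀ g ∈ R, name b g = name a g) ∧ (∀ g ∈ S, name c g = name a g) then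
          (nameClass A name U a : ℝ)⁻¹ * (nameClass A name (R ∪ S) a : ℝ)⁻¹ else 0) ≤
        if ∀ g ∈ U, name c g = name b g then (nameClass A name U b : ℝ)⁻¹ else 0 := by
      intro c _
      rw [← Finset.sum_filter]
      set B := A.filter fun a => (∀ g ∈ R, name b g = name a g) ∧ ∀ g ∈ S, name c g = name a g
        with hB
      rcases B.eq_empty_or_nonempty with h0 | ⟨a₀, ha₀⟩
      · rw [h0]
        simp only [Finset.sum_empty]
        split_ifs <;> positivity
      · have ha₀' := (Finset.mem_filter.1 ha₀)
        have hU : ∀ a ∈ B, ∀ g ∈ U, name a g = name b g := fun a ha g hg =>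
          ((Finset.mem_filter.1 ha).2.1 g (hR hg)).symm
        have hc : ∀ g ∈ U, name c g = name b g := fun g hg =>
          (ha₀'.2.2 g (hS hg)).trans (hU a₀ ha₀ g hg)
        have hRS : ∀ a ∈ B, ∀ g ∈ R ∪ S, name a g = name a₀ g := by
          intro a ha g hg
          have ha' := (Finset.mem_filter.1 ha).2
          rcases Finset.mem_union.1 hg with hg | hg
          · exact (ha'.1 g hg).symm.trans (ha₀'.2.1 g hg)
          · exact (ha'.2 g hg).symm.trans (ha₀'.2.2 g hg)
        rw [if_pos hc]
        have hle : B.card ≤ nameClass A name (R ∪ S) a₀ :=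
          Finset.card_le_card fun a ha => Finset.mem_filter.2
            ⟨(Finset.mem_filter.1 ha).1, hRS a ha⟩
        have hpos : (0 : ℝ) < nameClass A name (R ∪ S) a₀ := by
          exact_mod_cast nameClass_pos name _ ha₀'.1
        calc ∑ a ∈ B, (nameClass A name U a : ℝ)⁻¹ * (nameClass A name (R ∪ S) a : ℝ)⁻¹
            = ∑ a ∈ B, (nameClass A name U b : ℝ)⁻¹ * (nameClass A name (R ∪ S) a₀ : ℝ)⁻¹ := by
              refine Finset.sum_congr rfl fun a ha => ?_
              rw [nameClass_congr A name (hU a ha), nameClass_congr A name (hRS a ha)]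
          _ = (nameClass A name U b : ℝ)⁻¹ * (B.card / nameClass A name (R ∪ S) a₀) := by
              rw [Finset.sum_const, nsmul_eq_mul]; ring
          _ ≤ (nameClass A name U b : ℝ)⁻¹ * 1 := by
              gcongr
              rw [div_le_one hpos]
              exact_mod_cast hle
          _ = _ := mul_one _
    refine (Finset.sum_le_sum inner).trans ?_
    rw [← Finset.sum_filter, Finset.sum_const, nsmul_eq_mul]
    exact mul_inv_le_one
  refine (Finset.sum_comm.le.trans (le_of_eq ?_)).trans
    ((Finset.sum_le_sum bound).trans (by simp))
  exact Finset.sum_comm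

theorem nameEntropy_submodular (A : Finset α) (name : α → ι → κ) {U R S : Finset ι}
    (hR : U ⊆ R) (hS : U ⊆ S) :
    nameEntropy A name (R ∪ S) + nameEntropy A name U ≤
      nameEntropy A name R + nameEntropy A name S := by
  have h := sum_nameClass_ratio_le A name hR hS
  have h2 : ∑ a ∈ A, (Real.log (nameClass A name R a) + Real.log (nameClass A name S a) -
      Real.log (nameClass A name U a) - Real.log (nameClass A name (R ∪ S) a)) ≤
      ∑ a ∈ A, ((nameClass A name R a : ℝ) * nameClass A name S a /
      (nameClass A name U a * nameClass A name (R ∪ S) a) - 1) := by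
    refine Finset.sum_le_sum fun a ha => ?_
    have p : ∀ T, (0 : ℝ) < nameClass A name T a := fun T => by
      exact_mod_cast nameClass_pos name T ha
    have := Real.log_le_sub_one_of_pos (div_pos (mul_pos (p R) (p S)) (mul_pos (p U) (p (R ∪ S))))
    rw [Real.log_div (mul_pos (p R) (p S)).ne' (mul_pos (p U) (p (R ∪ S))).ne',
      Real.log_mul (p R).ne' (p S).ne', Real.log_mul (p U).ne' (p (R ∪ S)).ne'] at this
    linarith
  have h3 : nameEntropy A name (R ∪ S) + nameEntropy A name U -
      (nameEntropy A name R + nameEntropy A name S) =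
      ∑ a ∈ A, (Real.log (nameClass A name R a) + Real.log (nameClass A name S a) -
      Real.log (nameClass A name U a) - Real.log (nameClass A name (R ∪ S) a)) := by
    simp only [nameEntropy]
    rw [← Finset.sum_add_distrib, ← Finset.sum_add_distrib, ← Finset.sum_sub_distrib]
    exact Finset.sum_congr rfl fun a _ => by ring
  rw [Finset.sum_sub_distrib (s := A) (g := fun _ => (1 : ℝ)), Finset.sum_const, nsmul_eq_mul,
    mul_one] at h2
  linarith

/-- A modular function with the same total mass that is dominated by the name entropy; this is
Shearer's inequality in dual form. -/
theorem exists_modular_le_nameEntropy (A : Finset α) (name : α → ι → κ) (F : Finset ι) :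
    ∃ b : ι → ℝ, (∀ g, 0 ≤ b g) ∧ ∑ g ∈ F, b g = nameEntropy A name F ∧
      ∀ T ⊆ F, ∑ g ∈ T, b g ≤ nameEntropy A name T := by
  induction F using Finset.induction_on with
  | empty =>
    refine ⟨0, fun _ => le_rfl, by simp [nameEntropy_empty], fun T hT => ?_⟩
    rw [Finset.subset_empty.1 hT]
    simp [nameEntropy_empty]
  | insert g F hg ih =>
    obtain ⟨b, hb0, hbF, hbT⟩ := ih
    have hmono := nameEntropy_mono A name (Finset.subset_insert g F)
    have hout : ∀ T : Finset ι, g ∉ T →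
        ∑ i ∈ T, Function.update b g (nameEntropy A name (insert g F) - nameEntropy A name F) i =
          ∑ i ∈ T, b i := fun T hT => Finset.sum_congr rfl fun i hi =>
      Function.update_of_ne (fun h => hT (by rwa [← h])) _ _
    refine ⟨Function.update b g (nameEntropy A name (insert g F) - nameEntropy A name F),
      fun i => ?_, ?_, fun T hT => ?_⟩
    · by_cases h : i = g
      · subst h; simp [hmono]
      · simp [h, hb0]
    · rw [Finset.sum_insert hg, hout F hg, hbF]
      simp
    · by_cases hgT : g ∈ T
      · have hT' : T.erase g ⊆ F := by
          intro i hi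
          have := hT (Finset.mem_of_mem_erase hi)
          exact (Finset.mem_insert.1 this).resolve_left (Finset.ne_of_mem_erase hi)
        rw [← Finset.add_sum_erase T _ hgT, hout _ (Finset.notMem_erase g T)]
        have hs := nameEntropy_submodular A name hT' (Finset.erase_subset g T)
        have hu : F ∪ T = insert g F := by
          apply Finset.Subset.antisymm
          · exact Finset.union_subset (Finset.subset_insert _ _) hT
          · exact Finset.insert_subset (Finset.mem_union_right _ hgT) Finset.subset_union_left
        rw [hu] at hs
        have := hbT _ hT'
        simp only [Function.update_self]
        linarith
      · rw [hout T hgT]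
        exact hbT T fun i hi => (Finset.mem_insert.1 (hT hi)).resolve_left fun h => hgT (h ▸ hi)

/-- If a code with values in `C` determines the name of a point outside the positions `near`,
then the entropy of the name is at most that of the code plus the cost of the exceptional
positions. -/
theorem nameEntropy_le_of_code {Z : Type*} [DecidableEq Z] [Fintype κ] [Nonempty κ]
    (A : Finset α) (name : α → ι → κ) (T : Finset ι) (C : Finset Z) (c : α → Z)
    (hc : ∀ a ∈ A, c a ∈ C) (near : Z → Finset ι)
    (hnear : ∀ a ∈ A, ∀ b ∈ A, c a = c b → ∀ g ∈ T, g ∉ near (c a) → name a g = name b g) :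
    nameEntropy A name T ≤
      ∑ a ∈ A, (Real.log C.card + (near (c a)).card * Real.log (Fintype.card κ)) := by
  set Q : ℝ := (Fintype.card κ : ℝ) with hQ
  have hQpos : 0 < Q := by rw [hQ]; exact_mod_cast Fintype.card_pos
  rcases A.eq_empty_or_nonempty with rfl | ⟨a₀, ha₀⟩
  · simp [nameEntropy]
  have hCpos : (0 : ℝ) < C.card := by exact_mod_cast Finset.card_pos.2 ⟨_, hc a₀ ha₀⟩
  have hApos : (0 : ℝ) < A.card := by exact_mod_cast Finset.card_pos.2 ⟨_, ha₀⟩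
  have hsum : ∑ a ∈ A, ((nameClass A name T a : ℝ)⁻¹ * (Q ^ (near (c a)).card)⁻¹) ≤ C.card := by
    rw [← Finset.sum_fiberwise_of_maps_to hc]
    have : ∀ z ∈ C, ∑ a ∈ A with c a = z,
        ((nameClass A name T a : ℝ)⁻¹ * (Q ^ (near (c a)).card)⁻¹) ≤ 1 := by
      intro z _
      have h1 : ∑ a ∈ A with c a = z, ((nameClass A name T a : ℝ)⁻¹ * (Q ^ (near (c a)).card)⁻¹)
          ≤ ∑ a ∈ A with c a = z,
            ((((A.filter fun a => c a = z).filter fun b =>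
              (fun g : near z => name b g) = fun g : near z => name a g).card : ℝ)⁻¹ *
              (Q ^ (near z).card)⁻¹) := by
        refine Finset.sum_le_sum fun a ha => ?_
        have ha' := Finset.mem_filter.1 ha
        rw [ha'.2]
        gcongr
        · exact_mod_cast Finset.card_pos.2 ⟨a, by simp [ha'.1, ha'.2]⟩
        · refine Finset.card_le_card fun b hb => ?_
          simp only [Finset.mem_filter] at hb ⊢
          refine ⟨hb.1.1, fun g hg => ?_⟩
          by_cases hgn : g ∈ near z
          · exact congrFun hb.2 ⟨g, hgn⟩
          · exact hnear b hb.1.1 a ha'.1 (hb.1.2.trans ha'.2.symm) g hg (by rwa [hb.1.2])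
      refine h1.trans ?_
      rw [← Finset.sum_mul]
      have h2 := sum_inv_card_fiber_le (A.filter fun a => c a = z)
        (fun b => fun g : near z => name b g)
      rw [Fintype.card_fun, Fintype.card_coe] at h2
      push_cast at h2
      rw [← div_eq_mul_inv, div_le_one (by positivity)]
      exact h2
    refine (Finset.sum_le_sum this).trans (by simp)
  have hterm : ∀ a ∈ A, (Real.log A.card - Real.log (nameClass A name T a)) ≤
      (Real.log C.card + (near (c a)).card * Real.log Q) +
        ((A.card / C.card : ℝ) *
          ((nameClass A name T a : ℝ)⁻¹ * (Q ^ (near (c a)).card)⁻¹) - 1) := by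
    intro a ha
    have p : (0 : ℝ) < nameClass A name T a := by exact_mod_cast nameClass_pos name T ha
    have := Real.log_le_sub_one_of_pos (x := (A.card / C.card : ℝ) *
          ((nameClass A name T a : ℝ)⁻¹ * (Q ^ (near (c a)).card)⁻¹)) (by positivity)
    rw [Real.log_mul (by positivity) (by positivity), Real.log_div hApos.ne' hCpos.ne',
      Real.log_mul (by positivity) (by positivity), Real.log_inv, Real.log_inv,
      Real.log_pow] at this
    linarith
  refine (Finset.sum_le_sum hterm).trans ?_
  rw [Finset.sum_add_distrib, Finset.sum_sub_distrib, ← Finset.mul_sum]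
  have : (A.card / C.card : ℝ) *
      ∑ a ∈ A, ((nameClass A name T a : ℝ)⁻¹ * (Q ^ (near (c a)).card)⁻¹) ≤ A.card := by
    calc _ ≤ (A.card / C.card : ℝ) * C.card := by gcongr
      _ = _ := by field_simp
  simp only [Finset.sum_const, nsmul_eq_mul, mul_one]
  linarith

end NameEntropy

section FractionalTiling

theorem card_filter_mul_inv_mem_left [Group G] [DecidableEq G] (F T : Finset G) (h : G) :
    (F.filter fun g => g * h⁻¹ ∈ T).card = (T.filter fun f => f * h ∈ F).card := by
  refine Finset.card_nbij' (fun g => g * h⁻¹) (fun f => f * h) ?_ ?_ ?_ ?_ <;>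
    intro g hg <;> simp_all

theorem card_filter_mul_inv_mem_right [Group G] [DecidableEq G] (F T : Finset G) (g : G) :
    (F.filter fun h => g * h⁻¹ ∈ T).card ≤ T.card :=
  Finset.card_le_card_of_injOn (fun h => g * h⁻¹) (fun h hh => (Finset.mem_filter.1 hh).2)
    fun a _ b _ hab => by simpa using hab

/-- Transfer of a bound on the translates `Fs m * h` to a bound on `F`. A random shape `m`, drawn
with the probabilities `lam`, gives a fractional tiling of most of `F` by such translates. -/
theorem sum_le_of_fractional_tiling [Group G] [DecidableEq G] (F : Finset G) (b u : G → ℝ)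
    {L D κ τ : ℝ} (hL : 0 ≤ L) (hD : 0 ≤ D) (hbL : ∀ g ∈ F, b g ≤ L)
    (hu : ∀ g ∈ F, 0 ≤ u g) (S : Finset ℕ) (lam : ℕ → ℝ) (hlam0 : ∀ m ∈ S, 0 ≤ lam m)
    (hlam1 : ∑ m ∈ S, lam m = 1) (Fs : ℕ → Finset G) (hne : ∀ m, (Fs m).Nonempty)
    (bad : ℕ → G → Prop) [∀ m, DecidablePred (bad m)]
    (hbad : ∀ h ∈ F, ∑ m ∈ S, (if bad m h then lam m else 0) ≤ τ)
    (htile : ∀ m ∈ S, ∀ h ∈ F, ¬ bad m h → ∑ g ∈ F with g * h⁻¹ ∈ Fs m, b g ≤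
      D * (Fs m).card + ∑ g ∈ F with g * h⁻¹ ∈ Fs m, u g)
    (hinv : ∀ m ∈ S, ∀ f ∈ Fs m, ((F.filter fun h => f * h ∉ F).card : ℝ) ≤ κ * F.card) :
    ∑ g ∈ F, b g ≤ D * F.card + ∑ g ∈ F, u g + (κ + τ) * L * F.card := by
  classical
  set w : ℕ → G → ℝ := fun m h => if bad m h then 0 else lam m / (Fs m).card with hw
  set i : ℕ → G → G → ℝ := fun m h g => if g * h⁻¹ ∈ Fs m then 1 else 0 with hi
  set cov : G → ℝ := fun g => ∑ m ∈ S, ∑ h ∈ F, w m h * i m h g with hcov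
  have hcard : ∀ m, (0 : ℝ) < (Fs m).card := fun m => by exact_mod_cast (hne m).card_pos
  have hw0 : ∀ m ∈ S, ∀ h, 0 ≤ w m h := by
    intro m hm h
    simp only [hw]
    split_ifs
    · exact le_rfl
    · exact div_nonneg (hlam0 m hm) (hcard m).le
  have hw1 : ∀ m ∈ S, ∀ h, w m h ≤ lam m / (Fs m).card := by
    intro m hm h
    simp only [hw]
    split_ifs
    · exact div_nonneg (hlam0 m hm) (hcard m).le
    · exact le_rfl
  have hi0 : ∀ m h g, 0 ≤ i m h g := by
    intro m h g
    simp only [hi]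
    split_ifs <;> norm_num
  have hsumi : ∀ m h (v : G → ℝ),
      ∑ g ∈ F, v g * i m h g = ∑ g ∈ F with g * h⁻¹ ∈ Fs m, v g := by
    intro m h v
    simp [hi, Finset.sum_filter]
  have hcount : ∀ m h, ∑ g ∈ F, i m h g = ((Fs m).filter fun f => f * h ∈ F).card := by
    intro m h
    rw [← card_filter_mul_inv_mem_left]
    simp [hi]
  have hcov1 : ∀ g, cov g ≤ 1 := by
    intro g
    rw [← hlam1]
    refine Finset.sum_le_sum fun m hm => ?_
    calc ∑ h ∈ F, w m h * i m h g ≤ ∑ h ∈ F, lam m / (Fs m).card * i m h g :=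
          Finset.sum_le_sum fun h _ => mul_le_mul_of_nonneg_right (hw1 m hm h) (hi0 m h g)
      _ = lam m / (Fs m).card * (F.filter fun h => g * h⁻¹ ∈ Fs m).card := by
          rw [← Finset.mul_sum]; simp [hi]
      _ ≤ lam m / (Fs m).card * (Fs m).card := by
          have := div_nonneg (hlam0 m hm) (hcard m).le
          refine mul_le_mul_of_nonneg_left ?_ this
          exact_mod_cast card_filter_mul_inv_mem_right F (Fs m) g
      _ = lam m := div_mul_cancel₀ _ (hcard m).ne'
  have hswap : ∀ v : G → ℝ, ∑ g ∈ F, v g * cov g =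
      ∑ m ∈ S, ∑ h ∈ F, w m h * ∑ g ∈ F with g * h⁻¹ ∈ Fs m, v g := by
    intro v
    simp only [hcov, ← hsumi, Finset.mul_sum]
    rw [Finset.sum_comm]
    refine Finset.sum_congr rfl fun m _ => ?_
    rw [Finset.sum_comm]
    exact Finset.sum_congr rfl fun h _ => Finset.sum_congr rfl fun g _ => by ring
  have hcovered : ∑ g ∈ F, b g * cov g ≤ D * F.card + ∑ g ∈ F, u g := by
    have h1 : ∑ g ∈ F, b g * cov g ≤ ∑ m ∈ S, ∑ h ∈ F,
        w m h * (D * (Fs m).card + ∑ g ∈ F with g * h⁻¹ ∈ Fs m, u g) := by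
      rw [hswap]
      refine Finset.sum_le_sum fun m hm => Finset.sum_le_sum fun h hh => ?_
      by_cases hbd : bad m h
      · simp [hw, hbd]
      · exact mul_le_mul_of_nonneg_left (htile m hm h hh hbd) (hw0 m hm h)
    have h2 : ∑ m ∈ S, ∑ h ∈ F, w m h * (D * (Fs m).card) ≤ D * F.card := by
      calc _ ≤ ∑ m ∈ S, ∑ _h ∈ F, lam m * D := by
            refine Finset.sum_le_sum fun m hm => Finset.sum_le_sum fun h _ => ?_
            calc w m h * (D * (Fs m).card) ≤ lam m / (Fs m).card * (D * (Fs m).card) :=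
                  mul_le_mul_of_nonneg_right (hw1 m hm h) (mul_nonneg hD (hcard m).le)
              _ = lam m * D := by have := (hcard m).ne'; field_simp
        _ = (∑ m ∈ S, lam m) * (D * F.card) := by
            simp only [Finset.sum_const, nsmul_eq_mul, Finset.sum_mul]
            exact Finset.sum_congr rfl fun m _ => by ring
        _ = D * F.card := by rw [hlam1, one_mul]
    have h3 : ∑ g ∈ F, u g * cov g ≤ ∑ g ∈ F, u g := Finset.sum_le_sum fun g hg =>
      mul_le_of_le_one_right (hu g hg) (hcov1 g)
    rw [hswap] at h3
    simp only [mul_add, Finset.sum_add_distrib] at h1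
    linarith
  have hlow : (1 - κ - τ) * F.card ≤ ∑ g ∈ F, cov g := by
    have h1 : ∑ g ∈ F, cov g = ∑ m ∈ S, ∑ h ∈ F, w m h * ∑ g ∈ F, i m h g := by
      simp only [hcov, Finset.mul_sum]
      rw [Finset.sum_comm]
      exact Finset.sum_congr rfl fun m _ => Finset.sum_comm
    have h2 : ∀ m ∈ S, ∀ h ∈ F, lam m / (Fs m).card * ∑ g ∈ F, i m h g -
        (if bad m h then lam m else 0) ≤ w m h * ∑ g ∈ F, i m h g := by
      intro m hm h _
      by_cases hbd : bad m h
      · have : ∑ g ∈ F, i m h g ≤ (Fs m).card := by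
          rw [hcount]; exact_mod_cast Finset.card_filter_le _ _
        have h4 : lam m / (Fs m).card * ∑ g ∈ F, i m h g ≤ lam m := by
          calc _ ≤ lam m / (Fs m).card * (Fs m).card :=
                mul_le_mul_of_nonneg_left this (div_nonneg (hlam0 m hm) (hcard m).le)
            _ = _ := div_mul_cancel₀ _ (hcard m).ne'
        simp only [hw, if_pos hbd]
        linarith
      · simp [hw, hbd]
    have h3 : ∀ m ∈ S, lam m * ((1 - κ) * F.card) ≤
        ∑ h ∈ F, lam m / (Fs m).card * ∑ g ∈ F, i m h g := by
      intro m hm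
      have h5 : ∑ h ∈ F, ∑ g ∈ F, i m h g =
          ∑ f ∈ Fs m, ((F.filter fun h => f * h ∈ F).card : ℝ) := by
        simp only [hcount, Finset.card_filter, Nat.cast_sum]
        exact Finset.sum_comm
      have h6 : ∀ f ∈ Fs m, (1 - κ) * F.card ≤ ((F.filter fun h => f * h ∈ F).card : ℝ) := by
        intro f hf
        have h7 := Finset.card_filter_add_card_filter_not (s := F) (fun h => f * h ∈ F)
        have h8 : ((F.filter fun h => f * h ∈ F).card : ℝ) +
          (F.filter fun h => f * h ∉ F).card = F.card := by exact_mod_cast h7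
        have := hinv m hm f hf
        linarith
      rw [← Finset.mul_sum, h5]
      calc lam m * ((1 - κ) * F.card)
          = lam m / (Fs m).card * ∑ f ∈ Fs m, (1 - κ) * F.card := by
            have := (hcard m).ne'
            rw [Finset.sum_const, nsmul_eq_mul]
            field_simp
        _ ≤ _ := mul_le_mul_of_nonneg_left (Finset.sum_le_sum h6)
            (div_nonneg (hlam0 m hm) (hcard m).le)
    have h9 : ∑ m ∈ S, ∑ h ∈ F, (if bad m h then lam m else 0) ≤ τ * F.card := by
      rw [Finset.sum_comm]
      refine (Finset.sum_le_sum hbad).trans ?_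
      rw [Finset.sum_const, nsmul_eq_mul, mul_comm]
    have h10 : (1 - κ) * F.card ≤
        ∑ m ∈ S, ∑ h ∈ F, lam m / (Fs m).card * ∑ g ∈ F, i m h g := by
      calc (1 - κ) * F.card = ∑ m ∈ S, lam m * ((1 - κ) * F.card) := by
            rw [← Finset.sum_mul, hlam1, one_mul]
        _ ≤ _ := Finset.sum_le_sum h3
    have h11 := Finset.sum_le_sum fun m hm => Finset.sum_le_sum (h2 m hm)
    simp only [Finset.sum_sub_distrib] at h11
    rw [h1]
    linarith
  have huncov : ∑ g ∈ F, b g * (1 - cov g) ≤ ∑ g ∈ F, L * (1 - cov g) :=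
    Finset.sum_le_sum fun g hg =>
      mul_le_mul_of_nonneg_right (hbL g hg) (by linarith [hcov1 g])
  rw [← Finset.mul_sum, Finset.sum_sub_distrib, Finset.sum_const, nsmul_eq_mul, mul_one] at huncov
  have h12 : L * (F.card - ∑ g ∈ F, cov g) ≤ L * ((κ + τ) * F.card) :=
    mul_le_mul_of_nonneg_left (by linarith) hL
  have h13 : ∑ g ∈ F, b g = ∑ g ∈ F, b g * cov g + ∑ g ∈ F, b g * (1 - cov g) := by
    rw [← Finset.sum_add_distrib]
    exact Finset.sum_congr rfl fun g _ => by ring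
  linarith

end FractionalTiling

section Minimax

/-- Finite minimax: either some convex combination of the indicators of the `B m` is at most `τ`,
or some probability measure gives all the `B m` mass more than `τ`. -/
theorem exists_weights_or_exists_measure [Nonempty Y] [MeasurableSpace Y] (B : ℕ → Set Y)
    (hB : ∀ m, MeasurableSet (B m)) (S : Finset ℕ) (τ : ℝ) :
    (∃ lam : ℕ → ℝ, (∀ m ∈ S, 0 ≤ lam m) ∧ ∑ m ∈ S, lam m = 1 ∧
      ∀ y, ∑ m ∈ S, lam m * (B m).indicator 1 y ≤ τ) ∨
    ∃ μ : ProbabilityMeasure Y, ∀ m ∈ S, τ < (μ : Measure Y).real (B m) := by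
  classical
  set s : Set (S → ℝ) := {u | ∀ m, τ < u m} with hs
  set t : Set (S → ℝ) :=
    {u | ∃ μ : Measure Y, IsProbabilityMeasure μ ∧ ∀ m : S, u m = μ.real (B m)} with ht
  by_cases hdisj : Disjoint s t
  swap
  · right
    obtain ⟨u, hu1, μ, hμ, hu2⟩ := Set.not_disjoint_iff.1 hdisj
    exact ⟨⟨μ, hμ⟩, fun m hm => (hu1 ⟨m, hm⟩).trans_eq (hu2 ⟨m, hm⟩)⟩
  left
  have hs1 : Convex ℝ s := by
    have : s = Set.univ.pi fun _ : S => Set.Ioi τ := by ext u; simp [hs]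
    rw [this]
    exact convex_pi fun _ _ => convex_Ioi τ
  have hs2 : IsOpen s := by
    have : s = Set.univ.pi fun _ : S => Set.Ioi τ := by ext u; simp [hs]
    rw [this]
    exact isOpen_set_pi Set.finite_univ fun _ _ => isOpen_Ioi
  have ht1 : Convex ℝ t := by
    rintro u ⟨μ, hμ, hu⟩ v ⟨ν, hν, hv⟩ a b ha hb hab
    refine ⟨ENNReal.ofReal a • μ + ENNReal.ofReal b • ν, ⟨?_⟩, fun m => ?_⟩
    · simp [← ENNReal.ofReal_add ha hb, hab]
    · have := μ.smul_finite (ENNReal.ofReal_ne_top (r := a))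
      have := ν.smul_finite (ENNReal.ofReal_ne_top (r := b))
      rw [measureReal_add_apply, measureReal_ennreal_smul_apply, measureReal_ennreal_smul_apply]
      simp [hu, hv, ha, hb]
  obtain ⟨f, c, hfs, hft⟩ := geometric_hahn_banach_open hs1 hs2 ht1 hdisj
  set p : S → ℝ := fun m => - f (Pi.single m 1) with hp
  have hf : ∀ u : S → ℝ, f u = - ∑ m, u m * p m := by
    intro u
    conv_lhs => rw [← Finset.univ_sum_single u]
    rw [map_sum, ← Finset.sum_neg_distrib]
    refine Finset.sum_congr rfl fun m _ => ?_
    have : (Pi.single m (u m) : S → ℝ) = u m • Pi.single m (1 : ℝ) := by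
      rw [← Pi.single_smul]; simp
    rw [this, map_smul]
    simp [hp]
  have hp0 : ∀ m, 0 ≤ p m := by
    intro m
    by_contra! hneg
    set R : ℝ := max 0 ((c + ∑ k, (τ + 1) * p k) / (-p m)) with hR
    have hmem : (fun k => τ + 1 + if k = m then R else 0) ∈ s := by
      intro k
      have : (0 : ℝ) ≤ if k = m then R else 0 := by split_ifs <;> simp [hR]
      linarith
    have h1 := hfs _ hmem
    rw [hf] at h1
    simp only [add_mul, Finset.sum_add_distrib, ite_mul, zero_mul, Finset.sum_ite_eq',
      Finset.mem_univ, if_true] at h1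
    have h2 : (c + ∑ k, (τ + 1) * p k) / (-p m) ≤ R := le_max_right _ _
    rw [div_le_iff₀ (by linarith)] at h2
    simp only [add_mul, Finset.sum_add_distrib] at h2
    linarith
  have hdirac : ∀ y : Y, ∑ m : S, (B m).indicator 1 y * p m ≤ -c := by
    intro y
    have hmem : (fun m : S => (Measure.dirac y).real (B m)) ∈ t :=
      ⟨Measure.dirac y, inferInstance, fun _ => rfl⟩
    have h1 := hft _ hmem
    rw [hf] at h1
    have h2 : ∑ m : S, (B m).indicator 1 y * p m =
        ∑ m : S, (Measure.dirac y).real (B m) * p m := by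
      refine Finset.sum_congr rfl fun m _ => ?_
      rw [measureReal_def, Measure.dirac_apply' _ (hB m)]
      by_cases hy : y ∈ B m <;> simp [hy]
    linarith
  have hsum : ∀ r > τ, -c < r * ∑ m, p m := by
    intro r hr
    have := hfs (fun _ => r) (fun _ => hr)
    rw [hf, ← Finset.mul_sum] at this
    linarith
  have hP : 0 < ∑ m, p m := by
    refine (Finset.sum_nonneg fun m _ => hp0 m).lt_of_ne fun h0 => ?_
    have h1 := hsum (τ + 1) (by linarith)
    obtain ⟨y⟩ := ‹Nonempty Y›
    have h2 := hdirac y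
    have h3 : 0 ≤ ∑ m : S, (B m).indicator 1 y * p m :=
      Finset.sum_nonneg fun m _ => mul_nonneg (Set.indicator_nonneg (by simp) _) (hp0 m)
    rw [← h0] at h1
    linarith
  have hτ : -c ≤ τ * ∑ m, p m := by
    rw [← div_le_iff₀ hP]
    refine le_of_forall_gt_imp_ge_of_dense fun r hr => ?_
    rw [div_le_iff₀ hP]
    exact (hsum r hr).le
  refine ⟨fun m => if hm : m ∈ S then p ⟨m, hm⟩ / ∑ k, p k else 0, fun m hm => ?_, ?_,
    fun y => ?_⟩
  · simp only [hm, dif_pos]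
    exact div_nonneg (hp0 _) hP.le
  · rw [← Finset.sum_coe_sort]
    simp only [Finset.coe_mem, dif_pos, Subtype.coe_eta]
    rw [← Finset.sum_div, div_self hP.ne']
  · rw [← Finset.sum_coe_sort]
    simp only [Finset.coe_mem, dif_pos, Subtype.coe_eta]
    calc _ = (∑ m : S, (B m).indicator 1 y * p m) / ∑ k, p k := by
          rw [Finset.sum_div]
          exact Finset.sum_congr rfl fun m _ => by ring
      _ ≤ τ := by
          rw [div_le_iff₀ hP]
          exact (hdirac y).trans hτ

/-- If every point lies in only finitely many of the closed sets `B m`, then some convex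
combination of their indicators is uniformly small. -/
theorem exists_weights_of_eventually_notMem [MetricSpace Y] [CompactSpace Y] (B : ℕ → Set Y)
    (hB : ∀ m, IsClosed (B m)) (hfin : ∀ y, ∀ᶠ m in atTop, y ∉ B m) {τ : ℝ} (hτ : 0 < τ) :
    ∃ (S : Finset ℕ) (lam : ℕ → ℝ), (∀ m ∈ S, 0 ≤ lam m) ∧ ∑ m ∈ S, lam m = 1 ∧
      ∀ y, ∑ m ∈ S, lam m * (B m).indicator 1 y ≤ τ := by
  rcases isEmpty_or_nonempty Y with hY | hY
  · exact ⟨{0}, fun _ => 1, by simp, by simp, fun y => hY.elim y⟩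
  let _ : MeasurableSpace Y := borel Y
  have : BorelSpace Y := ⟨rfl⟩
  by_contra hcon
  have hμ : ∀ N : ℕ, ∃ μ : ProbabilityMeasure Y, ∀ m ∈ Finset.range N,
      τ < (μ : Measure Y).real (B m) := fun N =>
    (exists_weights_or_exists_measure B (fun m => (hB m).measurableSet) (Finset.range N)
      τ).resolve_left fun h => hcon ⟨_, h⟩
  choose μs hμs using hμ
  obtain ⟨μ, -, hμ⟩ := isCompact_univ.ultrafilter_le_nhds
    ((hyperfilter ℕ : Ultrafilter ℕ).map μs) (by simp)
  have hlim : Tendsto μs (hyperfilter ℕ : Filter ℕ) (𝓝 μ) := hμ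
  have hlow : ∀ m, ENNReal.ofReal τ ≤ (μ : Measure Y) (B m) := by
    intro m
    refine le_trans ?_ (ProbabilityMeasure.limsup_measure_closed_le_of_tendsto hlim (hB m))
    refine le_limsup_of_frequently_le (Eventually.frequently ?_)
    have : ∀ᶠ N in (hyperfilter ℕ : Filter ℕ), m < N := by
      have := Nat.hyperfilter_le_atTop
      exact this (eventually_gt_atTop m)
    filter_upwards [this] with N hN
    have := hμs N m (Finset.mem_range.2 hN)
    rw [measureReal_def] at this
    exact ENNReal.ofReal_le_of_le_toReal this.le
  have hzero : Tendsto (fun m => (μ : Measure Y) (B m)) atTop (𝓝 0) := by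
    have h1 := tendsto_measure_of_ae_tendsto_indicator_of_isFiniteMeasure (μ := (μ : Measure Y))
      (A := (∅ : Set Y)) (As := B) atTop MeasurableSet.empty (fun m => (hB m).measurableSet)
      (Eventually.of_forall fun y => by
        filter_upwards [hfin y] with m hm
        simp [hm])
    simpa using h1
  have := ge_of_tendsto' hzero hlow
  simp only [nonpos_iff_eq_zero, ENNReal.ofReal_eq_zero] at this
  linarith

end Minimax

section FiberBound

theorem bddAbove_card_separated [PseudoMetricSpace X] [CompactSpace X] (act : G → X → X)
    (hact : ∀ g, Continuous (act g)) (F : Finset G) (Z : Set X) {ε : ℝ} (hε : 0 < ε) :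
    BddAbove {k : ℕ | ∃ E : Finset X, ↑E ⊆ Z ∧ IsDynSeparated act F ε ↑E ∧ E.card = k} := by
  classical
  have hopen : ∀ c : X, IsOpen {x | ∀ g ∈ F, dist (act g x) (act g c) < ε / 2} := fun c => by
    have : {x | ∀ g ∈ F, dist (act g x) (act g c) < ε / 2} =
        ⋂ g ∈ F, {x | dist (act g x) (act g c) < ε / 2} := by ext; simp
    rw [this]
    exact isOpen_biInter_finset fun g _ =>
      isOpen_lt ((hact g).dist continuous_const) continuous_const
  obtain ⟨t, -, ht⟩ := isCompact_univ.elim_nhds_subcover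
    (fun c => {x | ∀ g ∈ F, dist (act g x) (act g c) < ε / 2})
    fun c _ => (hopen c).mem_nhds (by simp [hε])
  have hcov : ∀ x : X, ∃ c ∈ t, ∀ g ∈ F, dist (act g x) (act g c) < ε / 2 := fun x => by
    simpa using ht (mem_univ x)
  choose c hct hc using hcov
  refine ⟨t.card, ?_⟩
  rintro k ⟨E, -, hE, rfl⟩
  refine Finset.card_le_card_of_injOn c (fun x _ => hct x) fun x hx y hy hxy => ?_
  by_contra hne
  obtain ⟨g, hg, hlt⟩ := hE x hx y hy hne
  have h1 := hc x g hg
  have h2 := hc y g hg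
  rw [← hxy] at h2
  have := dist_triangle_right (act g x) (act g y) (act g (c x))
  linarith

theorem exists_spanning_card_eq_sepNum [PseudoMetricSpace X] [CompactSpace X] (act : G → X → X)
    (hact : ∀ g, Continuous (act g)) (F : Finset G) (Z : Set X) {ε : ℝ} (hε : 0 < ε) :
    ∃ C : Finset X, C.card = sepNum act F Z ε ∧
      ∀ x ∈ Z, ∃ z ∈ C, ∀ g ∈ F, dist (act g x) (act g z) ≤ ε := by
  classical
  have hb := bddAbove_card_separated act hact F Z hε
  obtain ⟨C, hCZ, hC, hcard⟩ := Nat.sSup_mem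
    (s := {k : ℕ | ∃ E : Finset X, ↑E ⊆ Z ∧ IsDynSeparated act F ε ↑E ∧ E.card = k})
    ⟨0, ∅, by simp, by simp [IsDynSeparated], rfl⟩ hb
  refine ⟨C, hcard, fun x hx => ?_⟩
  by_contra! hcon
  have hxC : x ∉ C := fun h => by
    obtain ⟨g, _, hg⟩ := hcon x h
    simp only [dist_self] at hg
    linarith
  have hmem : C.card + 1 ∈
      {k : ℕ | ∃ E : Finset X, ↑E ⊆ Z ∧ IsDynSeparated act F ε ↑E ∧ E.card = k} := by
    refine ⟨insert x C, ?_, ?_, Finset.card_insert_of_notMem hxC⟩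
    · rw [Finset.coe_insert]
      exact Set.insert_subset hx hCZ
    · intro u hu v hv huv
      rw [Finset.coe_insert] at hu hv
      rcases hu with rfl | hu <;> rcases hv with rfl | hv
      · exact absurd rfl huv
      · exact hcon v hv
      · obtain ⟨g, hg, h⟩ := hcon u hu
        exact ⟨g, hg, by rwa [dist_comm]⟩
      · exact hC u hu v hv huv
  have := le_csSup hb hmem
  rw [hcard] at this
  omega

/-- The preimage of `V` is covered by at most `exp (D * |F|)` dynamical balls of radius `η`. -/
def HasSmallCode [PseudoMetricSpace X] (act : G → X → X) (π : X → Y) (F : Finset G) (D η : ℝ)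
    (V : Set Y) : Prop :=
  ∃ C : Finset X, (C.card : ℝ) ≤ Real.exp (D * F.card) ∧
    ∀ x, π x ∈ V → ∃ z ∈ C, ∀ g ∈ F, dist (act g x) (act g z) ≤ η

theorem HasSmallCode.mono [PseudoMetricSpace X] {act : G → X → X} {π : X → Y} {F : Finset G}
    {D η : ℝ} {V W : Set Y} (h : HasSmallCode act π F D η W) (hVW : V ⊆ W) :
    HasSmallCode act π F D η V :=
  h.imp fun _ hC => ⟨hC.1, fun x hx => hC.2 x (hVW hx)⟩

theorem exists_open_hasSmallCode [MetricSpace X] [CompactSpace X] [MetricSpace Y]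
    (act : G → X → X) (hact : ∀ g, Continuous (act g)) (π : X → Y) (hπ : Continuous π)
    (F : Finset G) {D η : ℝ} (hη : 0 < η) (y : Y)
    (hy : (sepNum act F (π ⁻¹' {y}) (η / 2) : ℝ) ≤ Real.exp (D * F.card)) :
    ∃ V, IsOpen V ∧ y ∈ V ∧ HasSmallCode act π F D η V := by
  obtain ⟨C, hC, hspan⟩ := exists_spanning_card_eq_sepNum act hact F (π ⁻¹' {y}) (half_pos hη)
  set W : Set X := ⋃ z ∈ C, ⋂ g ∈ F, {x | dist (act g x) (act g z) < η} with hW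
  have hWo : IsOpen W := isOpen_biUnion fun z _ => isOpen_biInter_finset fun g _ =>
    isOpen_lt ((hact g).dist continuous_const) continuous_const
  refine ⟨(π '' Wᶜ)ᶜ, (hπ.isClosedMap _ hWo.isClosed_compl).isOpen_compl, ?_, C, by rwa [hC], ?_⟩
  · rintro ⟨x, hx, hxy⟩
    obtain ⟨z, hz, h⟩ := hspan x hxy
    refine hx ?_
    simp only [hW, mem_iUnion, mem_iInter, mem_ofPred_eq]
    exact ⟨z, hz, fun g hg => (h g hg).trans_lt (by linarith)⟩
  · intro x hx
    have hxW : x ∈ W := by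
      by_contra h
      exact hx ⟨x, h, rfl⟩
    simp only [hW, mem_iUnion, mem_iInter, mem_ofPred_eq] at hxW
    obtain ⟨z, hz, h⟩ := hxW
    exact ⟨z, hz, fun g hg => (h g hg).le⟩

/-- A finite probability vector on the scales such that, uniformly in `y`, most scales admit a
small code near `y`. -/
theorem exists_weights_hasSmallCode [MetricSpace X] [CompactSpace X] [MetricSpace Y]
    [CompactSpace Y] (act : G → X → X) (hact : ∀ g, Continuous (act g)) (π : X → Y)
    (hπ : Continuous π) (Fs : ℕ → Finset G) {D η τ : ℝ} (hη : 0 < η) (hτ : 0 < τ)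
    (hfib : ∀ y, ∀ᶠ m in atTop,
      (sepNum act (Fs m) (π ⁻¹' {y}) (η / 2) : ℝ) ≤ Real.exp (D * (Fs m).card)) :
    ∃ (S : Finset ℕ) (lam : ℕ → ℝ) (δ : ℝ), 0 < δ ∧ (∀ m ∈ S, 0 ≤ lam m) ∧
      ∑ m ∈ S, lam m = 1 ∧ ∀ (y : Y) (T : Finset ℕ), T ⊆ S →
        (∀ m ∈ T, ¬ HasSmallCode act π (Fs m) D η (Metric.closedBall y δ)) →
          ∑ m ∈ T, lam m ≤ τ := by
  classical
  set B : ℕ → Set Y := fun m =>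
    (⋃₀ {V | IsOpen V ∧ HasSmallCode act π (Fs m) D η V})ᶜ with hB
  have hBc : ∀ m, IsClosed (B m) := fun m =>
    (isOpen_sUnion fun V hV => hV.1).isClosed_compl
  have hBfin : ∀ y, ∀ᶠ m in atTop, y ∉ B m := by
    intro y
    filter_upwards [hfib y] with m hm
    obtain ⟨V, hV, hyV, hcode⟩ := exists_open_hasSmallCode act hact π hπ (Fs m) hη y hm
    simp only [hB, mem_compl_iff, not_not]
    exact ⟨V, ⟨hV, hcode⟩, hyV⟩
  obtain ⟨S, lam, hlam0, hlam1, hlam⟩ := exists_weights_of_eventually_notMem B hBc hBfin hτ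
  have hV : ∀ (y : Y) (m : ℕ), ∃ V, IsOpen V ∧ y ∈ V ∧
      (y ∉ B m → HasSmallCode act π (Fs m) D η V) := by
    intro y m
    by_cases hy : y ∈ B m
    · exact ⟨univ, isOpen_univ, mem_univ _, fun h => absurd hy h⟩
    · simp only [hB, mem_compl_iff, not_not] at hy
      obtain ⟨V, hV, hyV⟩ := hy
      exact ⟨V, hV.1, hyV, fun _ => hV.2⟩
  choose V hVo hyV hVcode using hV
  obtain ⟨δ, hδ, hleb⟩ := lebesgue_number_lemma_of_metric (isCompact_univ (X := Y))
    (c := fun y => ⋂ m ∈ S, V y m) (fun y => isOpen_biInter_finset fun m _ => hVo y m)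
    (fun y _ => mem_iUnion.2 ⟨y, mem_iInter₂.2 fun m _ => hyV y m⟩)
  refine ⟨S, lam, δ / 2, half_pos hδ, hlam0, hlam1, fun y T hT hbad => ?_⟩
  obtain ⟨y', hy'⟩ := hleb y (mem_univ y)
  refine le_trans ?_ (hlam y')
  calc ∑ m ∈ T, lam m = ∑ m ∈ T, lam m * (B m).indicator 1 y' := by
        refine Finset.sum_congr rfl fun m hm => ?_
        have : y' ∈ B m := by
          by_contra h
          refine hbad m hm ((hVcode y' m h).mono fun v hv => ?_)
          exact mem_iInter₂.1 (hy' (Metric.closedBall_subset_ball (half_lt_self hδ) hv)) m (hT hm)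
        simp [this]
    _ ≤ _ := Finset.sum_le_sum_of_subset_of_nonneg hT fun m hm _ =>
        mul_nonneg (hlam0 m hm) (Set.indicator_nonneg (by simp) _)

/-- Among `J` equally spaced radii, one gives spheres around the points of `P` that are rarely
approached by the points `x i`. -/
theorem exists_radius_rarely_near {ι : Type*} [PseudoMetricSpace X] (P : Finset X) (I : Finset ι)
    (x : ι → X) (r₀ : ℝ) {η : ℝ} (hη : 0 < η) {J : ℕ} (hJ : 0 < J) :
    ∃ j < J, (J : ℝ) * ((I.filter fun i => ∃ p ∈ P,
      |dist (x i) p - (r₀ + 8 * η * j)| ≤ 2 * η).card : ℝ) ≤ I.card * P.card := by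
  classical
  have hpt : ∀ i, ((Finset.range J).filter fun j : ℕ => ∃ p ∈ P,
      |dist (x i) p - (r₀ + 8 * η * j)| ≤ 2 * η).card ≤ P.card := by
    intro i
    have hsub : ((Finset.range J).filter fun j : ℕ => ∃ p ∈ P,
        |dist (x i) p - (r₀ + 8 * η * j)| ≤ 2 * η) ⊆ P.biUnion fun p =>
        (Finset.range J).filter fun j : ℕ => |dist (x i) p - (r₀ + 8 * η * j)| ≤ 2 * η := by
      intro j hj
      simp only [Finset.mem_filter, Finset.mem_biUnion] at hj ⊢
      obtain ⟨hj, p, hp, h⟩ := hj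
      exact ⟨p, hp, hj, h⟩
    refine (Finset.card_le_card hsub).trans ?_
    refine (Finset.card_biUnion_le_card_mul _ _ 1 fun p _ => ?_).trans (by simp)
    refine Finset.card_le_one.2 fun j hj k hk => ?_
    have h1 := abs_le.1 (Finset.mem_filter.1 hj).2
    have h2 := abs_le.1 (Finset.mem_filter.1 hk).2
    have h3 : (j : ℝ) < k + 1 := by
      by_contra! h
      nlinarith
    have h4 : (k : ℝ) < j + 1 := by
      by_contra! h
      nlinarith
    have h5 : j < k + 1 := by exact_mod_cast h3
    have h6 : k < j + 1 := by exact_mod_cast h4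
    omega
  have htot : ∑ j ∈ Finset.range J, (I.filter fun i => ∃ p ∈ P,
      |dist (x i) p - (r₀ + 8 * η * j)| ≤ 2 * η).card ≤ I.card * P.card := by
    simp only [Finset.card_filter]
    rw [Finset.sum_comm]
    simp only [← Finset.card_filter]
    exact (Finset.sum_le_sum fun i _ => hpt i).trans (by simp)
  by_contra! hcon
  have h1 : ∑ j ∈ Finset.range J, (I.card * P.card : ℝ) <
      ∑ j ∈ Finset.range J, (J : ℝ) * ((I.filter fun i => ∃ p ∈ P,
      |dist (x i) p - (r₀ + 8 * η * j)| ≤ 2 * η).card : ℝ) :=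
    Finset.sum_lt_sum_of_nonempty (by simpa using hJ.ne') fun j hj =>
      hcon j (Finset.mem_range.1 hj)
  rw [Finset.sum_const, Finset.card_range, nsmul_eq_mul, ← Finset.mul_sum] at h1
  have h2 := lt_of_mul_lt_mul_left h1 (by positivity)
  have h3 : (∑ j ∈ Finset.range J, ((I.filter fun i => ∃ p ∈ P,
      |dist (x i) p - (r₀ + 8 * η * j)| ≤ 2 * η).card : ℝ)) ≤ I.card * P.card := by
    exact_mod_cast htot
  linarith

theorem Folner.eventually_card_filter_le [Group G] [DecidableEq G] {Fs : ℕ → Finset G}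
    (hFol : Folner Fs) {κ : ℝ} (hκ : 0 < κ) (f : G) :
    ∀ᶠ n in atTop, (((Fs n).filter fun h => f * h ∉ Fs n).card : ℝ) ≤ κ * (Fs n).card := by
  filter_upwards [(hFol.2 f).eventually (gt_mem_nhds hκ)] with n hn
  have hpos : (0 : ℝ) < (Fs n).card := by exact_mod_cast (hFol.1 n).card_pos
  rw [div_lt_iff₀ hpos] at hn
  refine le_trans ?_ hn.le
  have : ((Fs n).filter fun h => f * h ∉ Fs n).card ≤
      (((Fs n).image fun h => f * h) ∆ Fs n).card := by
    refine Finset.card_le_card_of_injOn (fun h => f * h) (fun h hh => ?_)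
      fun a _ b _ hab => by simpa using hab
    obtain ⟨h1, h2⟩ := Finset.mem_filter.1 hh
    exact Finset.mem_coe.2 (Finset.mem_symmDiff.2 (Or.inl ⟨Finset.mem_image_of_mem _ h1, h2⟩))
  exact_mod_cast this

end FiberBound

section FiberCount

theorem mul_log_card_le_of_tiles [Group G] [DecidableEq G] [MetricSpace X] [MetricSpace Y]
    (actX : G → X → X) (actY : G → Y → Y)
    (hX_mul : ∀ g h x, actX (g * h) x = actX g (actX h x)) (π : X → Y)
    (Fs : ℕ → Finset G) (hne : ∀ m, (Fs m).Nonempty) {D κ τ δ ε η r : ℝ} (hD : 0 ≤ D)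
    (P : Finset X) (hP : ∀ x, ∃ p ∈ P, dist x p < ε / 4) (hr : ε / 4 ≤ r) (hr' : r ≤ ε / 2)
    (S : Finset ℕ) (lam : ℕ → ℝ) (hlam0 : ∀ m ∈ S, 0 ≤ lam m) (hlam1 : ∑ m ∈ S, lam m = 1)
    (hbad : ∀ (y : Y) (T : Finset ℕ), T ⊆ S →
      (∀ m ∈ T, ¬ HasSmallCode actX π (Fs m) D η (Metric.closedBall y δ)) →
        ∑ m ∈ T, lam m ≤ τ)
    (F : Finset G)
    (hinv : ∀ m ∈ S, ∀ f ∈ Fs m, ((F.filter fun h => f * h ∉ F).card : ℝ) ≤ κ * F.card)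
    (y : Y) (A : Finset X) (hsep : IsDynSeparated actX F ε (A : Set X))
    (hA : ∀ x ∈ A, ∀ g ∈ F, dist (π (actX g x)) (actY g y) ≤ δ) :
    A.card * Real.log A.card ≤ A.card * D * F.card +
      P.card * Real.log 2 * ((A ×ˢ F).filter fun i =>
        ∃ p ∈ P, |dist (actX i.2 i.1) p - r| ≤ 2 * η).card +
      (κ + τ) * (A.card * (P.card * Real.log 2)) * F.card := by
  classical
  set lQ : ℝ := P.card * Real.log 2 with hlQ
  have hlQ0 : 0 ≤ lQ := by positivity
  set name : X → G → (P → Bool) := fun a g p => decide (dist (actX g a) p < r) with hname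
  obtain ⟨b, -, hbF, hbT⟩ := exists_modular_le_nameEntropy A name F
  have hinj : nameEntropy A name F = A.card * Real.log A.card := by
    refine nameEntropy_of_injOn A name fun a ha a' ha' h => ?_
    by_contra hne
    obtain ⟨g, hg, hlt⟩ := hsep a' ha' a ha hne
    obtain ⟨p, hp, hd⟩ := hP (actX g a)
    have h1 := congrFun (h g hg) ⟨p, hp⟩
    have h2 : dist (actX g a) p < r := hd.trans_le hr
    have h3 : dist (actX g a') p < r := by simpa [hname, h2] using h1
    have := dist_triangle_right (actX g a') (actX g a) p
    linarith
  set u : G → ℝ := fun g => lQ * (A.filter fun a =>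
    ∃ p ∈ P, |dist (actX g a) p - r| ≤ 2 * η).card with hu
  have husum : ∑ g ∈ F, u g = lQ * ((A ×ˢ F).filter fun i =>
      ∃ p ∈ P, |dist (actX i.2 i.1) p - r| ≤ 2 * η).card := by
    simp only [hu, ← Finset.mul_sum, Finset.card_filter, Finset.sum_product_right]
    push_cast
    rfl
  have hbL : ∀ g ∈ F, b g ≤ A.card * lQ := by
    intro g hg
    have h1 := hbT {g} (by simpa using hg)
    have h2 := nameEntropy_le_of_code A name {g} {()} (fun _ => ()) (by simp) (fun _ => {g})
      (by simp)
    simpa using h1.trans h2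
  have key := sum_le_of_fractional_tiling F b u (L := A.card * lQ) (D := A.card * D)
    (κ := κ) (τ := τ) (by positivity) (by positivity) hbL (fun g _ => by positivity) S lam hlam0
    hlam1 Fs hne (fun m h => ¬ HasSmallCode actX π (Fs m) D η (Metric.closedBall (actY h y) δ))
    (fun h hh => by
      rw [← Finset.sum_filter]
      exact hbad (actY h y) _ (Finset.filter_subset _ _) fun m hm => (Finset.mem_filter.1 hm).2)
    (fun m hm h hh hcode => ?_) hinv
  · rwa [hbF, hinj, husum] at key
  · obtain ⟨C, hCcard, hC⟩ := not_not.1 hcode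
    have hcode' : ∀ a, ∃ z, a ∈ A → z ∈ C ∧
        ∀ g ∈ Fs m, dist (actX g (actX h a)) (actX g z) ≤ η := by
      intro a
      by_cases ha : a ∈ A
      · obtain ⟨z, hz, hzd⟩ := hC (actX h a) (Metric.mem_closedBall.2 (hA a ha h hh))
        exact ⟨z, fun _ => ⟨hz, hzd⟩⟩
      · exact ⟨a, fun h => absurd h ha⟩
    choose c hc using hcode'
    set T := F.filter fun g => g * h⁻¹ ∈ Fs m with hT
    have hclose : ∀ a ∈ A, ∀ g ∈ T, ∀ p : X,
        |dist (actX g a) p - dist (actX (g * h⁻¹) (c a)) p| ≤ η := by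
      intro a ha g hg p
      have h1 := (hc a ha).2 _ (Finset.mem_filter.1 hg).2
      rw [← hX_mul, inv_mul_cancel_right] at h1
      exact (abs_dist_sub_le _ _ _).trans h1
    set near : X → Finset G := fun z => T.filter fun g =>
      ∃ p ∈ P, |dist (actX (g * h⁻¹) z) p - r| ≤ η with hnear
    have hent := nameEntropy_le_of_code A name T C c (fun a ha => (hc a ha).1) near (by
      intro a ha a' ha' hcc g hg hgn
      have hfar : ∀ p ∈ P, η < |dist (actX (g * h⁻¹) (c a)) p - r| := by
        simpa [hnear, hg] using hgn
      funext p
      have h1 := abs_le.1 (hclose a ha g hg p)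
      have h2 := abs_le.1 (hclose a' ha' g hg p)
      rw [← hcc] at h2
      simp only [hname, decide_eq_decide]
      rcases lt_abs.1 (hfar p p.2) with h3 | h3 <;> constructor <;> intro h4 <;> linarith)
    refine (hbT T (Finset.filter_subset _ _)).trans (hent.trans ?_)
    have hlogκ : Real.log (Fintype.card (P → Bool)) = lQ := by simp [hlQ]
    rw [hlogκ, Finset.sum_add_distrib, Finset.sum_const, nsmul_eq_mul, mul_assoc]
    have hlogC : Real.log C.card ≤ D * (Fs m).card := by
      rcases Nat.eq_zero_or_pos C.card with h0 | h0
      · rw [h0]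
        simpa using by positivity
      · exact (Real.log_le_iff_le_exp (by exact_mod_cast h0)).2 hCcard
    refine add_le_add (mul_le_mul_of_nonneg_left hlogC (Nat.cast_nonneg _)) ?_
    have hnu : ∀ a ∈ A, near (c a) ⊆ T.filter fun g =>
        ∃ p ∈ P, |dist (actX g a) p - r| ≤ 2 * η := by
      intro a ha g hg
      obtain ⟨hgT, p, hp, h1⟩ := Finset.mem_filter.1 hg
      refine Finset.mem_filter.2 ⟨hgT, p, hp, ?_⟩
      have h2 := abs_le.1 (hclose a ha g hgT p)
      have h3 := abs_le.1 h1
      exact abs_le.2 ⟨by linarith, by linarith⟩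
    calc ∑ a ∈ A, ((near (c a)).card : ℝ) * lQ
        ≤ ∑ a ∈ A, ((T.filter fun g => ∃ p ∈ P, |dist (actX g a) p - r| ≤ 2 * η).card : ℝ) *
            lQ := by
          gcongr with a ha
          exact hnu a ha
      _ = ∑ g ∈ T, u g := by
          simp only [hu, ← Finset.mul_sum, ← Finset.sum_mul, Finset.card_filter]
          push_cast
          rw [Finset.sum_comm, mul_comm]

/-- Uniform version of the upper capacity entropy bound on fibers: separated sets whose images
stay close to an orbit in the base have exponentially bounded cardinality. -/
theorem exists_uniform_fiber_bound [Group G] [DecidableEq G] [MetricSpace X] [CompactSpace X]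
    [MetricSpace Y] [CompactSpace Y] (actX : G → X → X) (actY : G → Y → Y)
    (hX_mul : ∀ g h x, actX (g * h) x = actX g (actX h x)) (hX_cont : ∀ g, Continuous (actX g))
    (π : X → Y) (hπ : Continuous π) (Fs : ℕ → Finset G) (hFol : Folner Fs) {D γ ε : ℝ}
    (hD : 0 ≤ D) (hDγ : D < γ) (hε : 0 < ε)
    (hfib : ∀ η : ℝ, 0 < η → ∀ y, ∀ᶠ m in atTop,
      (sepNum actX (Fs m) (π ⁻¹' {y}) η : ℝ) ≤ Real.exp (D * (Fs m).card)) :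
    ∃ δ : ℝ, 0 < δ ∧ ∀ᶠ n in atTop, ∀ (y : Y) (A : Finset X),
      IsDynSeparated actX (Fs n) ε (A : Set X) →
      (∀ x ∈ A, ∀ g ∈ Fs n, dist (π (actX g x)) (actY g y) ≤ δ) →
        (A.card : ℝ) ≤ Real.exp (γ * (Fs n).card) := by
  classical
  obtain ⟨P, -, hP⟩ := (isCompact_univ (X := X)).elim_nhds_subcover
    (fun x => Metric.ball x (ε / 4)) fun x _ => Metric.ball_mem_nhds x (by positivity)
  have hP' : ∀ x, ∃ p ∈ P, dist x p < ε / 4 := fun x => by simpa using hP (mem_univ x)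
  set lQ : ℝ := P.card * Real.log 2 with hlQ
  have hlQ0 : 0 ≤ lQ := by positivity
  set ξ := γ - D with hξ
  have hξ0 : 0 < ξ := sub_pos.2 hDγ
  obtain ⟨J, hJ⟩ := exists_nat_gt (P.card * lQ / (ξ / 2))
  have hJ0 : (0 : ℝ) < J := lt_of_le_of_lt (by positivity) hJ
  have hJP : P.card * lQ ≤ J * (ξ / 2) := ((div_lt_iff₀ (by positivity)).1 hJ).le
  set η := ε / (64 * J) with hη
  have hη0 : 0 < η := by positivity
  set κ := ξ / (4 * (lQ + 1)) with hκ
  have hκ0 : 0 < κ := by positivity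
  obtain ⟨S, lam, δ, hδ, hlam0, hlam1, hbad⟩ := exists_weights_hasSmallCode actX hX_cont π hπ Fs
    (D := D) hη0 hκ0 (hfib (η / 2) (by positivity))
  have hev : ∀ᶠ n in atTop, ∀ m ∈ S, ∀ f ∈ Fs m,
      (((Fs n).filter fun h => f * h ∉ Fs n).card : ℝ) ≤ κ * (Fs n).card :=
    (Filter.eventually_all_finset S).2 fun m _ => (Filter.eventually_all_finset (Fs m)).2
      fun f _ => hFol.eventually_card_filter_le hκ0 f
  refine ⟨δ, hδ, hev.mono fun n hinv y A hsep hA => ?_⟩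
  rcases A.eq_empty_or_nonempty with rfl | hAne
  · simpa using (Real.exp_pos _).le
  have hA0 : (0 : ℝ) < A.card := by exact_mod_cast hAne.card_pos
  obtain ⟨j, hj, hcount⟩ := exists_radius_rarely_near P (A ×ˢ Fs n) (fun i => actX i.2 i.1)
    (ε / 4) hη0 (Nat.cast_pos.1 hJ0)
  have hηJ : 64 * (η * J) = ε := by rw [hη]; field_simp
  have hj' : (j : ℝ) ≤ J := by exact_mod_cast hj.le
  have hηj : η * j ≤ η * J := by gcongr
  have hηj0 : 0 ≤ η * j := by positivity
  have main := mul_log_card_le_of_tiles actX actY hX_mul π Fs hFol.1 hD (r := ε / 4 + 8 * η * j)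
    P hP' (by linarith) (by linarith) S lam hlam0 hlam1 hbad (Fs n) hinv y A hsep hA
  set N : ℝ := (((A ×ˢ Fs n).filter fun i =>
    ∃ p ∈ P, |dist (actX i.2 i.1) p - (ε / 4 + 8 * η * j)| ≤ 2 * η).card : ℝ) with hN
  rw [Finset.card_product] at hcount
  push_cast at hcount
  have hF0 : (0 : ℝ) ≤ (Fs n).card := Nat.cast_nonneg _
  have h1 : lQ * N ≤ A.card * (ξ / 2) * (Fs n).card := by
    refine le_of_mul_le_mul_left ?_ hJ0
    calc (J : ℝ) * (lQ * N) = lQ * (J * N) := by ring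
      _ ≤ lQ * (A.card * (Fs n).card * P.card) := by gcongr
      _ = A.card * (Fs n).card * (P.card * lQ) := by ring
      _ ≤ A.card * (Fs n).card * (J * (ξ / 2)) := by gcongr
      _ = _ := by ring
  have h2 : (κ + κ) * lQ ≤ ξ / 2 := by
    have : κ * (4 * (lQ + 1)) = ξ := by rw [hκ]; field_simp
    nlinarith
  have h3 : (κ + κ) * (A.card * lQ) * (Fs n).card ≤ A.card * (ξ / 2) * (Fs n).card := by
    calc (κ + κ) * (A.card * lQ) * (Fs n).card = A.card * ((κ + κ) * lQ) * (Fs n).card := by ring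
      _ ≤ _ := by gcongr
  have h4 : A.card * Real.log A.card ≤ A.card * (γ * (Fs n).card) := by
    have : A.card * (γ * (Fs n).card) = A.card * D * (Fs n).card +
        A.card * (ξ / 2) * (Fs n).card + A.card * (ξ / 2) * (Fs n).card := by
      rw [hξ]; ring
    linarith
  exact (Real.log_le_iff_le_exp hA0).1 (le_of_mul_le_mul_left h4 hA0)

end FiberCount

section Packing

theorem eventually_sepNum_le_exp [PseudoMetricSpace X] (act : G → X → X) (Fs : ℕ → Finset G)
    (hne : ∀ n, (Fs n).Nonempty) (Z : Set X) {D η : ℝ} (hη : 0 < η)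
    (h : ucEnt act Fs Z < ENNReal.ofReal D) :
    ∀ᶠ m in atTop, (sepNum act (Fs m) Z η : ℝ) ≤ Real.exp (D * (Fs m).card) := by
  have h1 : ucEntEps act Fs Z η < ENNReal.ofReal D :=
    (le_iSup₂ (f := fun (ε : ℝ) (_ : 0 < ε) => ucEntEps act Fs Z ε) η hη).trans_lt h
  filter_upwards [eventually_lt_of_limsup_lt h1] with m hm
  have hF : (0 : ℝ) < (Fs m).card := by exact_mod_cast (hne m).card_pos
  rcases Nat.eq_zero_or_pos (sepNum act (Fs m) Z η) with h0 | h0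
  · rw [h0]
    simpa using (Real.exp_pos _).le
  have hlt := (ENNReal.ofReal_lt_ofReal_iff_of_nonneg
    (div_nonneg (Real.log_natCast_nonneg _) hF.le)).1 hm
  rw [div_lt_iff₀ hF] at hlt
  exact (Real.log_le_iff_le_exp (by exact_mod_cast h0)).1 hlt.le

theorem tsum_le_packP [PseudoMetricSpace X] (act : G → X → X) (Fs : ℕ → Finset G) {Z : Set X}
    {N : ℕ} {ε s : ℝ} {ι : Type*} [Countable ι] (f : ι → X × ℕ)
    (hf : ∀ i, (f i).1 ∈ Z ∧ N ≤ (f i).2)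
    (hdisj : ∀ i j, i ≠ j → Disjoint (dynClosedBall act (Fs (f i).2) (f i).1 ε)
      (dynClosedBall act (Fs (f j).2) (f j).1 ε)) :
    ∑' i, ENNReal.ofReal (Real.exp (-s * ((Fs (f i).2).card : ℝ))) ≤ packP act Fs Z N ε s := by
  rcases isEmpty_or_nonempty ι with hι | ⟨⟨i₀⟩⟩
  · simp
  obtain ⟨e, he⟩ := exists_injective_nat ι
  have hc : ∀ i, Function.extend e f (fun _ => f i₀) (e i) = f i := he.extend_apply f _
  unfold packP
  refine le_iSup₂_of_le (range e) (Function.extend e f fun _ => f i₀) ?_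
  refine le_iSup₂_of_le ?_ ?_ ?_
  · rintro _ ⟨i, rfl⟩
    rw [hc]
    exact hf i
  · rintro _ ⟨i, rfl⟩ _ ⟨j, rfl⟩ hij
    rw [hc, hc]
    exact hdisj i j fun h => hij (h ▸ rfl)
  · rw [tsum_range (g := e) (fun k => ENNReal.ofReal (Real.exp (-s *
      ((Fs (Function.extend e f (fun _ => f i₀) k).2).card : ℝ)))) he]
    simp only [hc, le_refl]

theorem packEnt_image_le [MetricSpace X] [CompactSpace X] [MetricSpace Y]
    (actX : G → X → X) (actY : G → Y → Y) (π : X → Y) (hπ : Continuous π)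
    (hπ_equiv : ∀ g x, π (actX g x) = actY g (π x)) (Fs : ℕ → Finset G) (E : Set X) :
    packEnt actY Fs (π '' E) ≤ packEnt actX Fs E := by
  refine iSup₂_le fun ε hε => ?_
  obtain ⟨δ, hδ, hunif⟩ := Metric.uniformContinuous_iff.1
    (CompactSpace.uniformContinuous_of_continuous hπ) ε hε
  refine le_trans ?_ (le_iSup₂ (f := fun (ε : ℝ) (_ : 0 < ε) => packEntEps actX Fs E ε)
    (δ / 2) (half_pos hδ))
  have hball : ∀ F x z, z ∈ dynClosedBall actX F x (δ / 2) →
      π z ∈ dynClosedBall actY F (π x) ε := by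
    intro F x z hz g hg
    rw [← hπ_equiv, ← hπ_equiv]
    exact (hunif ((hz g hg).trans_lt (half_lt_self hδ))).le
  have hP : ∀ (Z : Set X) N s, packP actY Fs (π '' Z) N ε s ≤ packP actX Fs Z N (δ / 2) s := by
    intro Z N s
    refine iSup₂_le fun t c => iSup₂_le fun hc hd => ?_
    choose x hxZ hx using fun i : t => (hc i i.2).1
    refine tsum_le_packP actX Fs (fun i : t => (x i, (c i).2))
      (fun i => ⟨hxZ i, (hc i i.2).2⟩) fun i j hij => Set.disjoint_left.2 fun z hz hz' => ?_
    have h1 := hball _ _ _ hz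
    have h2 := hball _ _ _ hz'
    rw [hx] at h1 h2
    exact Set.disjoint_left.1 (hd i i.2 j j.2 fun h => hij (Subtype.ext h)) h1 h2
  have hout : ∀ s, packOuter actY Fs (π '' E) ε s ≤ packOuter actX Fs E (δ / 2) s := by
    intro s
    refine le_iInf₂ fun Zs hZs => iInf₂_le_of_le (fun i => π '' Zs i) ?_ ?_
    · rw [← image_iUnion]
      exact image_mono hZs
    · exact ENNReal.tsum_le_tsum fun i => iInf_mono fun N => hP _ _ _
  exact le_iInf₂ fun s hs => iInf₂_le s (nonpos_iff_eq_zero.1 ((hout s).trans hs.le))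

/-- The packing pre-measure of the image controls the number of disjoint Bowen balls of one
order `n`, once separated sets near the fibers are known to be small. -/
theorem card_mul_le_packP_mul [PseudoMetricSpace X] [PseudoMetricSpace Y]
    (actX : G → X → X) (actY : G → Y → Y) (π : X → Y)
    (hπ_equiv : ∀ g x, π (actX g x) = actY g (π x)) (Fs : ℕ → Finset G) {γ δ ε s : ℝ}
    (hε : 0 ≤ ε) (hδ : 0 ≤ δ) {n N : ℕ} (hn : N ≤ n)
    (hfib : ∀ (y : Y) (A : Finset X), IsDynSeparated actX (Fs n) ε (A : Set X) →
      (∀ x ∈ A, ∀ g ∈ Fs n, dist (π (actX g x)) (actY g y) ≤ 2 * δ) →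
        (A.card : ℝ) ≤ Real.exp (γ * (Fs n).card))
    (Z : Set Y) (A : Finset X) (hA : ∀ x ∈ A, π x ∈ Z)
    (hdisj : ∀ x ∈ A, ∀ x' ∈ A, x ≠ x' →
      Disjoint (dynClosedBall actX (Fs n) x ε) (dynClosedBall actX (Fs n) x' ε)) :
    (A.card : ℝ≥0∞) * ENNReal.ofReal (Real.exp (-s * (Fs n).card)) ≤
      packP actY Fs Z N δ s * ENNReal.ofReal (Real.exp (γ * (Fs n).card)) := by
  classical
  have hsep : ∀ B ⊆ A, IsDynSeparated actX (Fs n) ε (B : Set X) := by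
    intro B hB x hx x' hx' hne
    by_contra! h
    have hmem : x' ∈ dynClosedBall actX (Fs n) x ε := h
    have hmem' : x' ∈ dynClosedBall actX (Fs n) x' ε := fun g _ => by simpa using hε
    exact Set.disjoint_left.1 (hdisj x (hB hx) x' (hB hx') hne) hmem hmem'
  have hself : ∀ x, π x ∈ dynClosedBall actY (Fs n) (π x) δ := fun x g _ => by simpa using hδ
  set good : Finset X → Prop := fun B => ∀ x ∈ B, ∀ x' ∈ B, x ≠ x' →
    Disjoint (dynClosedBall actY (Fs n) (π x) δ) (dynClosedBall actY (Fs n) (π x') δ) with hgood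
  obtain ⟨B, hB, hmax⟩ := Finset.exists_max_image (A.powerset.filter good) Finset.card
    ⟨∅, by simp [hgood]⟩
  simp only [Finset.mem_filter, Finset.mem_powerset] at hB hmax
  obtain ⟨hBA, hBgood⟩ := hB
  have hnear : ∀ x ∈ A, ∃ x' ∈ B, ¬ Disjoint (dynClosedBall actY (Fs n) (π x) δ)
      (dynClosedBall actY (Fs n) (π x') δ) := by
    intro x hx
    by_contra! hcon
    have hxB : x ∉ B := fun h => Set.disjoint_left.1 (hcon x h) (hself x) (hself x)
    have := hmax (insert x B) ⟨Finset.insert_subset hx hBA, ?_⟩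
    · rw [Finset.card_insert_of_notMem hxB] at this
      omega
    · intro u hu v hv huv
      rw [Finset.mem_insert] at hu hv
      rcases hu with rfl | hu <;> rcases hv with rfl | hv
      · exact absurd rfl huv
      · exact hcon v hv
      · exact (hcon u hu).symm
      · exact hBgood u hu v hv huv
  have hcard : (A.card : ℝ) ≤ B.card * Real.exp (γ * (Fs n).card) := by
    have hsub : A ⊆ B.biUnion fun x' => A.filter fun x =>
        ¬ Disjoint (dynClosedBall actY (Fs n) (π x) δ) (dynClosedBall actY (Fs n) (π x') δ) := by
      intro x hx
      obtain ⟨x', hx', h⟩ := hnear x hx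
      exact Finset.mem_biUnion.2 ⟨x', hx', Finset.mem_filter.2 ⟨hx, h⟩⟩
    calc (A.card : ℝ) ≤ ∑ x' ∈ B, ((A.filter fun x =>
          ¬ Disjoint (dynClosedBall actY (Fs n) (π x) δ)
            (dynClosedBall actY (Fs n) (π x') δ)).card : ℝ) := by
          exact_mod_cast (Finset.card_le_card hsub).trans Finset.card_biUnion_le
      _ ≤ ∑ x' ∈ B, Real.exp (γ * (Fs n).card) := by
          refine Finset.sum_le_sum fun x' _ => hfib (π x') _ (hsep _ (Finset.filter_subset _ _)) ?_
          intro x hx g hg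
          obtain ⟨z, hz, hz'⟩ := Set.not_disjoint_iff.1 (Finset.mem_filter.1 hx).2
          rw [hπ_equiv]
          have h1 := hz g hg
          have h2 := hz' g hg
          have := dist_triangle_right (actY g (π x)) (actY g (π x')) (actY g z)
          linarith
      _ = _ := by rw [Finset.sum_const, nsmul_eq_mul]
  have hpack : (B.card : ℝ≥0∞) * ENNReal.ofReal (Real.exp (-s * (Fs n).card)) ≤
      packP actY Fs Z N δ s := by
    have := tsum_le_packP actY Fs (Z := Z) (N := N) (ε := δ) (s := s)
      (fun x : B => (π x, n)) (fun x => ⟨hA x (hBA x.2), hn⟩)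
      fun x x' h => hBgood x x.2 x' x'.2 fun h' => h (Subtype.ext h')
    simpa [tsum_fintype] using this
  have hcard' : (A.card : ℝ≥0∞) ≤ B.card * ENNReal.ofReal (Real.exp (γ * (Fs n).card)) := by
    have := ENNReal.ofReal_le_ofReal hcard
    rwa [ENNReal.ofReal_mul (Nat.cast_nonneg _), ENNReal.ofReal_natCast,
      ENNReal.ofReal_natCast] at this
  calc _ ≤ (B.card * ENNReal.ofReal (Real.exp (γ * (Fs n).card))) *
        ENNReal.ofReal (Real.exp (-s * (Fs n).card)) := by gcongr
    _ = (B.card * ENNReal.ofReal (Real.exp (-s * (Fs n).card))) *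
        ENNReal.ofReal (Real.exp (γ * (Fs n).card)) := by ring
    _ ≤ _ := by gcongr

theorem GrowthCond.summable_exp [Group G] {Fs : ℕ → Finset G} (h : GrowthCond Fs) {c : ℝ}
    (hc : 0 < c) : Summable fun n => Real.exp (-c * (Fs n).card) := by
  refine Summable.of_norm_bounded_eventually_nat (Real.summable_one_div_nat_pow.2 one_lt_two) ?_
  filter_upwards [h.eventually_ge_atTop (2 / c), eventually_ge_atTop 2] with n hn hn2
  have hn0 : (0 : ℝ) < n := by positivity
  have hlog : 0 < Real.log n := Real.log_pos (by exact_mod_cast hn2)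
  rw [div_le_div_iff₀ hc hlog] at hn
  rw [Real.norm_of_nonneg (Real.exp_pos _).le, one_div, ← Real.exp_log (inv_pos.2 (pow_pos hn0 2)),
    Real.log_inv, Real.log_pow]
  refine Real.exp_le_exp.2 ?_
  push_cast
  linarith

theorem packPLim_preimage_eq_zero [Group G] [PseudoMetricSpace X] [PseudoMetricSpace Y]
    (actX : G → X → X) (actY : G → Y → Y) (π : X → Y)
    (hπ_equiv : ∀ g x, π (actX g x) = actY g (π x)) (Fs : ℕ → Finset G) (hgrow : GrowthCond Fs)
    {γ δ ε s s₀ : ℝ} (hε : 0 ≤ ε) (hδ : 0 ≤ δ) (hs : s₀ + γ < s)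
    (hfib : ∀ᶠ n in atTop, ∀ (y : Y) (A : Finset X), IsDynSeparated actX (Fs n) ε (A : Set X) →
      (∀ x ∈ A, ∀ g ∈ Fs n, dist (π (actX g x)) (actY g y) ≤ 2 * δ) →
        (A.card : ℝ) ≤ Real.exp (γ * (Fs n).card))
    (Z : Set Y) (hZ : packPLim actY Fs Z δ s₀ < ∞) :
    packPLim actX Fs (π ⁻¹' Z) ε s = 0 := by
  classical
  obtain ⟨N₀, hN₀⟩ := iInf_lt_iff.1 hZ
  obtain ⟨n₀, hn₀⟩ := eventually_atTop.1 hfib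
  set K := packP actY Fs Z N₀ δ s₀ with hK
  set f : ℕ → ℝ≥0∞ := fun n => K * ENNReal.ofReal (Real.exp (-(s - s₀ - γ) * (Fs n).card)) with hf
  have hfsum : ∑' n, f n ≠ ∞ := by
    rw [hf, ENNReal.tsum_mul_left]
    exact ENNReal.mul_ne_top hN₀.ne (hgrow.summable_exp (by linarith)).tsum_ofReal_ne_top
  have hle : ∀ N, N₀ ≤ N → n₀ ≤ N → packP actX Fs (π ⁻¹' Z) N ε s ≤ ∑' k, f (k + N) := by
    intro N hN hN'
    refine iSup₂_le fun t c => iSup₂_le fun hc hd => ?_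
    rw [← ENNReal.tsum_fiberwise _ fun i : t => (c i).2 - N]
    refine ENNReal.tsum_le_tsum fun k => ?_
    rw [ENNReal.tsum_eq_iSup_sum]
    refine iSup_le fun I => ?_
    have hI : ∀ i ∈ I, (c i.1).2 = k + N := by
      rintro ⟨i, hi⟩ -
      have h1 : (c i).2 - N = k := hi
      have h2 := (hc i i.2).2
      change (c i).2 = k + N
      omega
    have hdI : ∀ i ∈ I, ∀ j ∈ I, i ≠ j → Disjoint
        (dynClosedBall actX (Fs (k + N)) (c i.1).1 ε)
        (dynClosedBall actX (Fs (k + N)) (c j.1).1 ε) := by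
      intro i hi j hj hij
      have := hd i.1 i.1.2 j.1 j.1.2 fun h => hij (Subtype.ext (Subtype.ext h))
      rwa [hI i hi, hI j hj] at this
    have hself : ∀ x, x ∈ dynClosedBall actX (Fs (k + N)) x ε := fun x g _ => by simpa using hε
    have hinj : Set.InjOn (fun i : (fun i : t => (c i).2 - N) ⁻¹' {k} => (c i.1).1) I := by
      intro i hi j hj hij
      by_contra hne
      refine Set.disjoint_left.1 (hdI i hi j hj hne) (hself _) ?_
      have h : (c i.1).1 = (c j.1).1 := hij
      rw [h]
      exact hself _
    have key := card_mul_le_packP_mul actX actY π hπ_equiv Fs (s := s₀) hε hδ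
      (hN.trans (Nat.le_add_left N k)) (hn₀ _ (hN'.trans (Nat.le_add_left N k))) Z
      (I.image fun i => (c i.1).1)
      (by
        intro x hx
        obtain ⟨i, -, rfl⟩ := Finset.mem_image.1 hx
        exact (hc i.1 i.1.2).1)
      (by
        intro x hx x' hx' hne
        obtain ⟨i, hi, rfl⟩ := Finset.mem_image.1 hx
        obtain ⟨j, hj, rfl⟩ := Finset.mem_image.1 hx'
        exact hdI i hi j hj fun h => hne (h ▸ rfl))
    rw [Finset.card_image_of_injOn hinj] at key
    have hmul : ∀ a b : ℝ, ENNReal.ofReal (Real.exp (a * (Fs (k + N)).card)) *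
        ENNReal.ofReal (Real.exp (b * (Fs (k + N)).card)) =
        ENNReal.ofReal (Real.exp ((a + b) * (Fs (k + N)).card)) := by
      intro a b
      rw [← ENNReal.ofReal_mul (Real.exp_pos _).le, ← Real.exp_add, add_mul]
    calc ∑ i ∈ I, ENNReal.ofReal (Real.exp (-s * (Fs (c i.1).2).card))
        = I.card * ENNReal.ofReal (Real.exp (-s * (Fs (k + N)).card)) := by
          rw [Finset.sum_congr rfl fun i hi => by rw [hI i hi], Finset.sum_const, nsmul_eq_mul]
      _ = I.card * ENNReal.ofReal (Real.exp (-s₀ * (Fs (k + N)).card)) *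
          ENNReal.ofReal (Real.exp ((s₀ - s) * (Fs (k + N)).card)) := by
          rw [mul_assoc, hmul]
          ring_nf
      _ ≤ K * ENNReal.ofReal (Real.exp (γ * (Fs (k + N)).card)) *
          ENNReal.ofReal (Real.exp ((s₀ - s) * (Fs (k + N)).card)) := by gcongr
      _ = f (k + N) := by
          rw [mul_assoc, hmul, hf]
          ring_nf
  refine nonpos_iff_eq_zero.1 (ge_of_tendsto (ENNReal.tendsto_sum_nat_add f hfsum) ?_)
  filter_upwards [eventually_ge_atTop N₀, eventually_ge_atTop n₀] with N hN hN'
  exact (iInf_le _ N).trans (hle N hN hN')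

theorem packOuter_eq_zero_of_image [Group G] [PseudoMetricSpace X] [PseudoMetricSpace Y]
    (actX : G → X → X) (actY : G → Y → Y) (π : X → Y)
    (hπ_equiv : ∀ g x, π (actX g x) = actY g (π x)) (Fs : ℕ → Finset G) (hgrow : GrowthCond Fs)
    {γ δ ε s s₀ : ℝ} (hε : 0 ≤ ε) (hδ : 0 ≤ δ) (hs : s₀ + γ < s)
    (hfib : ∀ᶠ n in atTop, ∀ (y : Y) (A : Finset X), IsDynSeparated actX (Fs n) ε (A : Set X) →
      (∀ x ∈ A, ∀ g ∈ Fs n, dist (π (actX g x)) (actY g y) ≤ 2 * δ) →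
        (A.card : ℝ) ≤ Real.exp (γ * (Fs n).card))
    (E : Set X) (hE : packOuter actY Fs (π '' E) δ s₀ = 0) :
    packOuter actX Fs E ε s = 0 := by
  obtain ⟨Zs, h⟩ := iInf_lt_iff.1 (hE.trans_lt ENNReal.zero_lt_top)
  obtain ⟨hcov, hlt⟩ := iInf_lt_iff.1 h
  have hz : ∀ i, packPLim actX Fs (π ⁻¹' Zs i) ε s = 0 := fun i =>
    packPLim_preimage_eq_zero actX actY π hπ_equiv Fs hgrow hε hδ hs hfib _
      ((ENNReal.le_tsum i).trans_lt hlt)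
  refine nonpos_iff_eq_zero.1 (iInf₂_le_of_le (fun i => π ⁻¹' Zs i) ?_ ?_)
  · rw [← preimage_iUnion]
    exact image_subset_iff.1 hcov
  · simp [hz]

theorem packEnt_le_packEnt_image_add [Group G] [DecidableEq G] [MetricSpace X] [CompactSpace X]
    [MetricSpace Y] [CompactSpace Y] (actX : G → X → X) (actY : G → Y → Y)
    (hX_mul : ∀ g h x, actX (g * h) x = actX g (actX h x)) (hX_cont : ∀ g, Continuous (actX g))
    (π : X → Y) (hπ : Continuous π) (hπ_equiv : ∀ g x, π (actX g x) = actY g (π x))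
    (Fs : ℕ → Finset G) (hFol : Folner Fs) (hgrow : GrowthCond Fs) (E : Set X) :
    packEnt actX Fs E ≤ packEnt actY Fs (π '' E) + ⨆ y : Y, ucEnt actX Fs (π ⁻¹' {y}) := by
  refine ENNReal.le_of_forall_pos_le_add fun e he hfin => ?_
  obtain ⟨hh, ha⟩ := ENNReal.add_lt_top.1 hfin
  generalize haa : ⨆ y : Y, ucEnt actX Fs (π ⁻¹' {y}) = a' at ha ⊢
  lift a' to ℝ≥0 using ha.ne with a
  refine iSup₂_le fun ε hε => ?_
  have he' : (0 : ℝ) < e := he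
  obtain ⟨δ, hδ, hfib⟩ := exists_uniform_fiber_bound actX actY hX_mul hX_cont π hπ Fs hFol
    (D := a + e / 4) (γ := a + e / 2) (by positivity) (by linarith) hε
    fun η hη y => eventually_sepNum_le_exp actX Fs hFol.1 _ hη <| by
      refine ((le_iSup (fun y : Y => ucEnt actX Fs (π ⁻¹' {y})) y).trans haa.le).trans_lt ?_
      rw [← ENNReal.ofReal_coe_nnreal]
      exact (ENNReal.ofReal_lt_ofReal_iff (by positivity)).2 (by linarith)
  have hlt : packEntEps actY Fs (π '' E) (δ / 2) <
      packEnt actY Fs (π '' E) + ((e / 4 : ℝ≥0) : ℝ≥0∞) :=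
    (le_iSup₂ (f := fun (ε : ℝ) (_ : 0 < ε) => packEntEps actY Fs (π '' E) ε)
      (δ / 2) (half_pos hδ)).trans_lt
      (ENNReal.lt_add_right hh.ne (by simpa using he.ne'))
  obtain ⟨s₀, h⟩ := iInf_lt_iff.1 hlt
  obtain ⟨hs₀, hlt⟩ := iInf_lt_iff.1 h
  have hout : packOuter actX Fs E ε ((s₀ + a + 3 * e / 4 : ℝ≥0) : ℝ) = 0 :=
    packOuter_eq_zero_of_image actX actY π hπ_equiv Fs hgrow (γ := a + e / 2) (δ := δ / 2)
      (s₀ := s₀) hε.le (by positivity) (by push_cast; linarith)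
      (by simpa only [mul_div_cancel₀ δ (two_ne_zero' ℝ)] using hfib) E hs₀
  calc packEntEps actX Fs E ε ≤ ((s₀ + a + 3 * e / 4 : ℝ≥0) : ℝ≥0∞) :=
        iInf₂_le (s₀ + a + 3 * e / 4 : ℝ≥0) hout
    _ = s₀ + (a + ((3 * e / 4 : ℝ≥0) : ℝ≥0∞)) := by
        rw [ENNReal.coe_add, ENNReal.coe_add, add_assoc]
    _ ≤ (packEnt actY Fs (π '' E) + ((e / 4 : ℝ≥0) : ℝ≥0∞)) +
        (a + ((3 * e / 4 : ℝ≥0) : ℝ≥0∞)) := by gcongr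
    _ = packEnt actY Fs (π '' E) + a + ((e / 4 + 3 * e / 4 : ℝ≥0) : ℝ≥0∞) := by
        rw [ENNReal.coe_add]
        ring
    _ = packEnt actY Fs (π '' E) + a + e := by
        congr 3
        field_simp
        norm_num

end Packing

theorem packing_entropy_factor_inequalities
    [Group G] [Countable G] [Infinite G] [DecidableEq G]
    [MetricSpace X] [CompactSpace X] [MeasurableSpace X] [BorelSpace X]
    [MetricSpace Y] [CompactSpace Y] [MeasurableSpace Y] [BorelSpace Y]
    (actX : G → X → X) (actY : G → Y → Y)
    (hX_one : ∀ x, actX 1 x = x) (hX_mul : ∀ g h x, actX (g * h) x = actX g (actX h x))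
    (hX_cont : ∀ g : G, Continuous (actX g))
    (hY_one : ∀ y, actY 1 y = y) (hY_mul : ∀ g h y, actY (g * h) y = actY g (actY h y))
    (hY_cont : ∀ g : G, Continuous (actY g))
    (π : X → Y) (hπ_cont : Continuous π) (hπ_surj : Function.Surjective π)
    (hπ_equiv : ∀ g x, π (actX g x) = actY g (π x))
    (Fs : ℕ → Finset G) (hFol : Folner Fs) (htemp : Tempered Fs) (hgrow : GrowthCond Fs)
    (E : Set X) (hE : MeasurableSet E) :
    packEnt actY Fs (π '' E) ≤ packEnt actX Fs E ∧
    packEnt actX Fs E ≤ packEnt actY Fs (π '' E) + ⨆ y : Y, ucEnt actX Fs (π ⁻¹' {y}) := by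
  exact ⟨packEnt_image_le actX actY π hπ_cont hπ_equiv Fs E,
    packEnt_le_packEnt_image_add actX actY hX_mul hX_cont π hπ_cont hπ_equiv Fs hFol hgrow E⟩

end AmenablePacking
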